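/- arXiv:1710.00907 — 7 statements merged into one kernel-verified Lean document; each statement's English description precedes it below -/
import Mathlib

section
/- Let R be a reduced commutative Noetherian ring, Q = Q(R) its total quotient ring (a finite product of fields), M a finitely generated R-module, and h an R-linear endomorphism of M. Then M ⊗_R Q is a finitely generated projective Q-module and the trace of the induced Q-linear endomorphism h ⊗_R Q of M ⊗_R Q lies in the integral closure of R in Q. -/
open TensorProduct

/-- `t` is the trace of the endomorphism `h` of a finitely generated projective module `P`,
expressed via a finite dual family `(eᵢ, φᵢ)` with `y = ∑ φᵢ(y) • eᵢ` for all `y`;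
this agrees with the trace defined via the isomorphism
`Hom(P,A) ⊗ P ≅ End(P)` followed by evaluation, and with the usual matrix trace
when `P` is free. -/
def IsTraceOf {A : Type*} [CommRing A] {P : Type*} [AddCommGroup P] [Module A P]
    (h : P →ₗ[A] P) (t : A) : Prop :=
  ∃ (n : ℕ) (e : Fin n → P) (φ : Fin n → (P →ₗ[A] A)),
    (∀ y : P, y = ∑ i, φ i y • e i) ∧ t = ∑ i, φ i (h (e i))

/-- The trace of a matrix over a field that is integral over `R` is integral over `R`. -/
theorem Matrix.isIntegral_trace_of_field {R K n : Type*} [CommRing R] [Field K] [Algebra R K]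
    [Fintype n] [DecidableEq n] {A : Matrix n n K} (hA : IsIntegral R A) :
    IsIntegral R A.trace := by
  let L := AlgebraicClosure K
  let g : K →ₐ[R] L := IsScalarTower.toAlgHom R K L
  obtain ⟨p, hp, hpB⟩ := hA.map g.mapMatrix
  have hroot : ∀ x ∈ (g.mapMatrix A).charpoly.roots, IsIntegral R x := by
    intro x hx
    have hx' := Matrix.mem_spectrum_iff_isRoot_charpoly.mpr (Polynomial.isRoot_of_mem_roots hx)
    have hmem := spectrum.subset_polynomial_aeval (g.mapMatrix A) (p.map (algebraMap R L))
      ⟨x, hx', rfl⟩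
    rw [← Polynomial.aeval_def] at hpB
    rw [Polynomial.aeval_map_algebraMap, hpB] at hmem
    refine ⟨p, hp, ?_⟩
    rw [← Polynomial.eval_map]
    by_contra hne
    rw [spectrum.mem_iff, sub_zero] at hmem
    exact hmem ((isUnit_iff_ne_zero.mpr hne).map (algebraMap L _))
  refine (isIntegral_algHom_iff g (algebraMap K L).injective).mp ?_
  have htr : g A.trace = (g.mapMatrix A).trace := AddMonoidHom.map_trace g.toAddMonoidHom A
  rw [htr, Matrix.trace_eq_sum_roots_charpoly]
  exact IsIntegral.multiset_sum hroot

/-- In a reduced ring with finitely many minimal primes, integrality may be checked modulo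
the minimal primes. -/
theorem isIntegral_of_forall_minimalPrimes {R S : Type*} [CommRing R] [CommRing S] [Algebra R S]
    [IsReduced S] (hfin : (minimalPrimes S).Finite) {x : S}
    (hx : ∀ P ∈ minimalPrimes S, IsIntegral R (Ideal.Quotient.mk P x)) : IsIntegral R x := by
  classical
  choose! p hp hpx using hx
  refine ⟨∏ P ∈ hfin.toFinset, p P,
    Polynomial.monic_prod_of_monic _ _ fun P hP ↦ hp P (hfin.mem_toFinset.mp hP), ?_⟩
  rw [← Polynomial.aeval_def]
  have hmem : Polynomial.aeval x (∏ P ∈ hfin.toFinset, p P) ∈ sInf (minimalPrimes S) := by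
    refine Submodule.mem_sInf.mpr fun P hP ↦ ?_
    rw [map_prod]
    refine Ideal.mem_of_dvd _ (Finset.dvd_prod_of_mem _ (hfin.mem_toFinset.mpr hP)) ?_
    rw [← Ideal.Quotient.eq_zero_iff_mem, ← Ideal.Quotient.mkₐ_eq_mk R,
      ← Polynomial.aeval_algHom_apply]
    exact hpx P hP
  have hbot : sInf (minimalPrimes S) = (⊥ : Ideal S) := by
    rw [minimalPrimes, Ideal.sInf_minimalPrimes]
    exact (nilradical_eq_zero S)
  rwa [hbot] at hmem

/-- The trace of an integral matrix over a reduced ring with finitely many minimal primes is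
integral. -/
theorem Matrix.isIntegral_trace {R S n : Type*} [CommRing R] [CommRing S] [Algebra R S]
    [IsReduced S] (hfin : (minimalPrimes S).Finite) [Fintype n] [DecidableEq n]
    {A : Matrix n n S} (hA : IsIntegral R A) : IsIntegral R A.trace := by
  refine isIntegral_of_forall_minimalPrimes hfin fun P hP ↦ ?_
  have : P.IsPrime := hP.1.1
  let K := FractionRing (S ⧸ P)
  have hinj : Function.Injective (IsScalarTower.toAlgHom R (S ⧸ P) K) :=
    IsFractionRing.injective (S ⧸ P) K
  refine (isIntegral_algHom_iff _ hinj).mp ?_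
  let g : S →ₐ[R] K := (IsScalarTower.toAlgHom R (S ⧸ P) K).comp (Ideal.Quotient.mkₐ R P)
  have htr : g A.trace = (g.mapMatrix A).trace := AddMonoidHom.map_trace g.toAddMonoidHom A
  change IsIntegral R (g A.trace)
  rw [htr]
  exact Matrix.isIntegral_trace_of_field (hA.map g.mapMatrix)

/-- If `E ∘ F = id`, then conjugating an integral endomorphism `h` to `F ∘ h ∘ E` preserves
integrality. -/
theorem LinearMap.isIntegral_comp_comp {R A P N : Type*} [CommRing R] [CommRing A] [Algebra R A]
    [AddCommGroup P] [Module A P] [Module R P] [IsScalarTower R A P]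
    [AddCommGroup N] [Module A N] [Module R N] [IsScalarTower R A N]
    {h : Module.End A P} (hh : IsIntegral R h) (E : N →ₗ[A] P) (F : P →ₗ[A] N)
    (hEF : E ∘ₗ F = LinearMap.id) :
    IsIntegral R (F ∘ₗ h ∘ₗ E : Module.End A N) := by
  obtain ⟨p, hp, hph⟩ := hh
  rw [← Polynomial.aeval_def] at hph
  set f : Module.End A N := F ∘ₗ h ∘ₗ E with hf
  have hEF' (y : P) : E (F y) = y := LinearMap.congr_fun hEF y
  have hcomm (q : Polynomial R) (y : P) :
      Polynomial.aeval f q (F y) = F (Polynomial.aeval h q y) := by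
    induction q using Polynomial.induction_on' generalizing y with
    | add a b ha hb => simp [ha, hb]
    | monomial k c =>
      have hpow : (f ^ k) (F y) = F ((h ^ k) y) := by
        induction k with
        | zero => simp
        | succ k ih =>
          rw [pow_succ', Module.End.mul_apply, ih, pow_succ', Module.End.mul_apply]
          simp [hf, hEF']
      simp only [Polynomial.aeval_monomial, Module.End.mul_apply, hpow]
      rw [IsScalarTower.algebraMap_apply R A (Module.End A N),
        IsScalarTower.algebraMap_apply R A (Module.End A P)]
      simp
  refine ⟨p * Polynomial.X, hp.mul Polynomial.monic_X, ?_⟩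
  rw [← Polynomial.aeval_def]
  ext x
  rw [map_mul, Polynomial.aeval_X, Module.End.mul_apply]
  change Polynomial.aeval f p (F (h (E x))) = 0
  rw [hcomm, hph]
  simp

/-- A trace of an integral endomorphism, over a reduced ring with finitely many minimal primes,
is integral. -/
theorem IsTraceOf.isIntegral {R A P : Type*} [CommRing R] [CommRing A] [Algebra R A]
    [IsReduced A] (hfin : (minimalPrimes A).Finite)
    [AddCommGroup P] [Module A P] [Module R P] [IsScalarTower R A P]
    {h : Module.End A P} (hh : IsIntegral R h) {t : A} (ht : IsTraceOf h t) :
    IsIntegral R t := by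
  obtain ⟨n, e, φ, hy, rfl⟩ := ht
  have hint := LinearMap.isIntegral_comp_comp hh (Fintype.linearCombination A e)
    (LinearMap.pi φ) (by ext y; simpa [Fintype.linearCombination_apply] using (hy y).symm)
  have := Matrix.isIntegral_trace hfin
    (hint.map ((LinearMap.toMatrixAlgEquiv' (R := A) (n := Fin n)).toAlgHom.restrictScalars R))
  convert this using 1
  simp [Matrix.trace, LinearMap.toMatrixAlgEquiv'_apply]

/-- A reduced Noetherian ring in which every nonzerodivisor is a unit is Artinian. -/
theorem isArtinianRing_of_isUnit_of_mem_nonZeroDivisors {A : Type*} [CommRing A]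
    [IsNoetherianRing A] [IsReduced A] (hA : ∀ a ∈ nonZeroDivisors A, IsUnit a) :
    IsArtinianRing A := by
  have hfin : (minimalPrimes A).Finite := minimalPrimes.finite_of_isNoetherianRing A
  have hmin (I : Ideal A) (hI : I.IsPrime) : I ∈ minimalPrimes A := by
    have hsub : (I : Set A) ⊆ ⋃ P ∈ hfin.toFinset, (P : Set A) := by
      intro a ha
      have hna : a ∉ nonZeroDivisors A := fun h ↦
        hI.ne_top (Ideal.eq_top_of_isUnit_mem _ ha (hA a h))
      obtain ⟨b, hab, hb⟩ : ∃ b, a * b = 0 ∧ b ≠ 0 := by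
        by_contra! hc
        exact hna (mem_nonZeroDivisors_iff_right.mpr fun b hb ↦ hc b (by rwa [mul_comm]))
      obtain ⟨P, hP, hbP⟩ : ∃ P ∈ minimalPrimes A, b ∉ P := by
        by_contra! hc
        refine hb ?_
        have : b ∈ sInf (minimalPrimes A) := Submodule.mem_sInf.mpr hc
        rw [minimalPrimes, Ideal.sInf_minimalPrimes] at this
        exact IsNilpotent.eq_zero (mem_nilradical.mp this)
      have hPp : P.IsPrime := hP.1.1
      simp only [Set.Finite.mem_toFinset, Set.mem_iUnion]
      exact ⟨P, hP, (hPp.mem_or_mem (hab ▸ P.zero_mem)).resolve_right hbP⟩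
    obtain ⟨P, hP, hle⟩ := (Ideal.subset_union_prime (f := id) ⊥ ⊥
      fun P hP _ _ ↦ (hfin.mem_toFinset.mp hP).1.1).mp hsub
    have hP' := hfin.mem_toFinset.mp hP
    rwa [le_antisymm hle (hP'.2 ⟨hI, bot_le⟩ hle)]
  rw [isArtinianRing_iff_krullDimLE_zero]
  refine Ring.KrullDimLE.mk₀ fun I hI ↦ ?_
  obtain ⟨m, hm, hIm⟩ := Ideal.exists_le_maximal I hI.ne_top
  rwa [le_antisymm hIm ((hmin m hm.isPrime).2 ⟨hI, bot_le⟩ hIm)]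

/-- Let `R` be a reduced commutative Noetherian ring, `Q = Q(R)` its total quotient ring,
`M` a finitely generated `R`-module, and `h` an `R`-linear endomorphism of `M`.  Then
`M ⊗[R] Q` is a finitely generated projective `Q`-module and the trace of the induced
endomorphism `h ⊗[R] Q` lies in the integral closure of `R` in `Q`. -/
theorem trace_mem_integralClosure
    (R : Type*) [CommRing R] [IsNoetherianRing R] [IsReduced R]
    (Q : Type*) [CommRing Q] [Algebra R Q] [IsLocalization (nonZeroDivisors R) Q]
    (M : Type*) [AddCommGroup M] [Module R M] [Module.Finite R M]
    (h : M →ₗ[R] M) :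
    Module.Finite Q (Q ⊗[R] M) ∧ Module.Projective Q (Q ⊗[R] M) ∧
      ∀ t : Q, IsTraceOf (h.baseChange Q) t → t ∈ integralClosure R Q := by
  have : IsNoetherianRing Q := IsLocalization.isNoetherianRing (nonZeroDivisors R) Q inferInstance
  have : IsReduced Q := isReduced_of_injective
    (IsLocalization.algEquiv (nonZeroDivisors R) Q (Localization (nonZeroDivisors R)))
    (AlgEquiv.injective _)
  have : IsArtinianRing Q := isArtinianRing_of_isUnit_of_mem_nonZeroDivisors fun a ha ↦
    by
    rwa [IsFractionRing.nonZeroDivisors_eq_isUnit R Q] at ha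
  have : IsSemisimpleRing Q := IsArtinianRing.isSemisimpleRing_of_isReduced Q
  refine ⟨inferInstance, Module.projective_of_isSemisimpleRing _ _, fun t ht ↦ ?_⟩
  have hh : IsIntegral R (h.baseChange Q : Module.End Q (Q ⊗[R] M)) :=
    (Module.End.isIntegral.isIntegral h).map (Module.End.baseChangeHom R Q M)
  exact ht.isIntegral (minimalPrimes.finite_of_isNoetherianRing Q) hh
end

section
/- Let R be a reduced complete Noetherian local ring of Krull dimension one with maximal ideal m, Q = Q(R) its total quotient ring, and R̄ the integral closure of R in Q. Let M be a finitely generated R-module and h an R-linear endomorphism of M such that h^n ∈ m·End_R(M) for some n ≥ 1. Then the trace of h ⊗_R Q, an endomorphism of the finitely generated projective Q-module M ⊗_R Q, lies in the Jacobson radical of R̄. -/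
open TensorProduct

open Polynomial

/-- `x` is a root of a monic polynomial over `R` which reduces to a power of `X` modulo `I`. -/
def IsIntegralOverRadical {R A : Type*} [CommRing R] [CommRing A] [Algebra R A]
    (I : Ideal R) (x : A) : Prop :=
  ∃ (p : R[X]) (N : ℕ), p.Monic ∧ p.map (Ideal.Quotient.mk I) = X ^ N ∧ aeval x p = 0

theorem Polynomial.Monic.map_mk_eq_X_pow {R : Type*} [CommRing R] {I : Ideal R} {p : R[X]}
    (hp : p.Monic) (h : ∀ i ≠ p.natDegree, p.coeff i ∈ I) :
    p.map (Ideal.Quotient.mk I) = X ^ p.natDegree := by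
  ext i
  rw [coeff_map, coeff_X_pow]
  split_ifs with hi
  · rw [hi, hp.coeff_natDegree, map_one]
  · exact Ideal.Quotient.eq_zero_iff_mem.mpr (h i hi)

namespace IsIntegralOverRadical

variable {R A : Type*} [CommRing R] [CommRing A] [Algebra R A] {I : Ideal R} {x : A}

theorem isIntegral (h : IsIntegralOverRadical I x) : IsIntegral R x :=
  let ⟨p, _, hp, _, hx⟩ := h
  ⟨p, hp, by rwa [← aeval_def]⟩

theorem of_algHom {B : Type*} [CommRing B] [Algebra R B] (f : A →ₐ[R] B)
    (hf : Function.Injective f) (h : IsIntegralOverRadical I (f x)) :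
    IsIntegralOverRadical I x := by
  obtain ⟨p, N, hp, hN, hx⟩ := h
  refine ⟨p, N, hp, hN, hf ?_⟩
  rw [← aeval_algHom_apply, hx, map_zero]

theorem of_pow {k : ℕ} (hk : 0 < k) (h : IsIntegralOverRadical I (x ^ k)) :
    IsIntegralOverRadical I x := by
  obtain ⟨p, N, hp, hN, hx⟩ := h
  refine ⟨expand R k p, k * N, hp.expand hk, ?_, by rwa [expand_aeval]⟩
  rw [map_expand, hN, map_pow, expand_X, pow_mul]

theorem mem_radical_map (h : IsIntegralOverRadical I x) :
    x ∈ (I.map (algebraMap R A)).radical := by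
  obtain ⟨p, N, hp, hN, hx⟩ := h
  refine ⟨N, ?_⟩
  rw [← Ideal.Quotient.eq_zero_iff_mem]
  let φ := Ideal.Quotient.mk (I.map (algebraMap R A))
  have hI : ∀ r ∈ I, φ.comp (algebraMap R A) r = 0 := fun r hr =>
    Ideal.Quotient.eq_zero_iff_mem.mpr (Ideal.mem_map_of_mem (algebraMap R A) hr)
  have key : eval₂ (Ideal.Quotient.lift I (φ.comp (algebraMap R A)) hI) (φ x)
      (p.map (Ideal.Quotient.mk I)) = φ (aeval x p) := by
    rw [eval₂_map, Ideal.Quotient.lift_comp_mk, aeval_def, hom_eval₂]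
  rw [hN, hx, map_zero, eval₂_X_pow] at key
  rw [map_pow, key]

theorem of_mem_radical_map [Algebra.IsIntegral R A]
    (h : x ∈ (I.map (algebraMap R A)).radical) : IsIntegralOverRadical I x := by
  obtain ⟨k, hk⟩ := h
  obtain ⟨p, hp, hx, hI⟩ := exists_monic_aeval_eq_zero_forall_mem_of_mem_map
    (Ideal.mul_mem_left _ x hk)
  rw [← pow_succ'] at hx
  exact of_pow k.succ_pos ⟨p, _, hp, hp.map_mk_eq_X_pow hI, hx⟩

theorem iff_mem_radical_map [Algebra.IsIntegral R A] :
    IsIntegralOverRadical I x ↔ x ∈ (I.map (algebraMap R A)).radical :=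
  ⟨mem_radical_map, of_mem_radical_map⟩

theorem multiset_sum {s : Multiset A} (hs : ∀ a ∈ s, IsIntegralOverRadical I a) :
    IsIntegralOverRadical I s.sum := by
  let S := integralClosure R A
  have lift_iff (a : S) : IsIntegralOverRadical I (a : A) ↔
      a ∈ (I.map (algebraMap R S)).radical := by
    rw [← iff_mem_radical_map]
    refine ⟨of_algHom S.val Subtype.val_injective, fun ⟨p, N, hp, hN, hx⟩ => ⟨p, N, hp, hN, ?_⟩⟩
    rw [← S.coe_val, aeval_algHom_apply, hx, map_zero]
  obtain ⟨b, hb, hb'⟩ : ∃ b : S, (b : A) = s.sum ∧ b ∈ (I.map (algebraMap R S)).radical := by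
    induction s using Multiset.induction with
    | empty => exact ⟨0, by simp, zero_mem _⟩
    | cons a s ih =>
      obtain ⟨b, hb, hb'⟩ := ih fun c hc => hs c (Multiset.mem_cons_of_mem hc)
      have ha := hs a (Multiset.mem_cons_self a s)
      refine ⟨⟨a, ha.isIntegral⟩ + b, by simp [hb], add_mem ((lift_iff _).mp ha) hb'⟩
  rw [← hb]
  exact (lift_iff b).mpr hb'

theorem of_forall_quotient_maximal [Finite (MaximalSpectrum A)]
    (hA : ∀ y : A, (∀ P : MaximalSpectrum A, y ∈ P.asIdeal) → y = 0)
    (h : ∀ P : MaximalSpectrum A, IsIntegralOverRadical I (Ideal.Quotient.mk P.asIdeal x)) :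
    IsIntegralOverRadical I x := by
  have := Fintype.ofFinite (MaximalSpectrum A)
  choose p N hp hN hx using h
  refine ⟨∏ P, p P, ∑ P, N P, monic_prod_of_monic _ _ fun P _ => hp P, ?_, hA _ fun P => ?_⟩
  · rw [Polynomial.map_prod, Finset.prod_congr rfl fun P _ => hN P, Finset.prod_pow_eq_pow_sum]
  · have hP := hx P
    rw [← Ideal.Quotient.mkₐ_eq_mk R, aeval_algHom_apply, Ideal.Quotient.mkₐ_eq_mk,
      Ideal.Quotient.eq_zero_iff_mem] at hP
    rw [map_prod]
    exact Ideal.mem_of_dvd _ (Finset.dvd_prod_of_mem _ (Finset.mem_univ P)) hP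

theorem mem_jacobson_bot [IsLocalRing R] [Algebra.IsIntegral R A]
    (h : IsIntegralOverRadical (IsLocalRing.maximalIdeal R) x) :
    x ∈ Ideal.jacobson (⊥ : Ideal A) := by
  refine Ideal.mem_sInf.mpr fun {J} ⟨_, hJ⟩ => ?_
  have hmax : (J.comap (algebraMap R A)).IsMaximal :=
    Ideal.isMaximal_comap_of_isIntegral_of_isMaximal J
  have hle : (IsLocalRing.maximalIdeal R).map (algebraMap R A) ≤ J := by
    rw [Ideal.map_le_iff_le_comap, IsLocalRing.eq_maximalIdeal hmax]
  exact hJ.isPrime.radical_le_iff.mpr hle h.mem_radical_map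

theorem trace {L V : Type*} [Field L] [IsAlgClosed L] [Algebra R L] [AddCommGroup V]
    [Module L V] [Module.Finite L V] {f : Module.End L V} {p : R[X]} {N : ℕ} (hp : p.Monic)
    (hN : p.map (Ideal.Quotient.mk I) = X ^ N) (hf : aeval f (p.map (algebraMap R L)) = 0) :
    IsIntegralOverRadical I (LinearMap.trace L V f) := by
  rw [Module.End.trace_eq_sum_roots_charpoly_of_splits (IsAlgClosed.splits _)]
  refine multiset_sum fun a ha => ⟨p, N, hp, hN, ?_⟩
  have hroot := (Module.End.hasEigenvalue_iff_isRoot_charpoly f a).mpr (isRoot_of_mem_roots ha)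
  obtain ⟨v, hv⟩ := hroot.exists_hasEigenvector
  have hv' := Module.End.aeval_apply_of_hasEigenvector (p := p.map (algebraMap R L)) hv
  rw [hf, LinearMap.zero_apply] at hv'
  rw [← eval_map_algebraMap]
  exact (smul_eq_zero.mp hv'.symm).resolve_right hv.2

end IsIntegralOverRadical

namespace IsTraceOf

variable {A : Type*} [CommRing A] {P : Type*} [AddCommGroup P] [Module A P]
  {h : P →ₗ[A] P} {t : A}

theorem trace_eq [Module.Free A P] [Module.Finite A P] (ht : IsTraceOf h t) :
    LinearMap.trace A P h = t := by
  obtain ⟨n, e, φ, he, rfl⟩ := ht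
  have hsum : h = dualTensorHom A P P (∑ i, φ i ⊗ₜ[A] h (e i)) := by
    ext y
    conv_lhs => rw [he y]
    simp
  conv_lhs => rw [hsum]
  rw [LinearMap.trace_eq_contract_apply]
  simp

theorem baseChange (B : Type*) [CommRing B] [Algebra A B] (ht : IsTraceOf h t) :
    IsTraceOf (h.baseChange B) (algebraMap A B t) := by
  obtain ⟨n, e, φ, he, rfl⟩ := ht
  refine ⟨n, fun i => 1 ⊗ₜ e i,
    fun i => (TensorProduct.AlgebraTensorModule.rid A B B).toLinearMap ∘ₗ (φ i).baseChange B,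
    fun y => ?_, by simp [Algebra.algebraMap_eq_smul_one]⟩
  induction y with
  | zero => simp
  | add x y hx hy =>
    conv_lhs => rw [hx, hy]
    simp only [map_add, add_smul, Finset.sum_add_distrib]
  | tmul b y =>
    conv_lhs => rw [he y]
    simp [TensorProduct.tmul_sum, TensorProduct.smul_tmul']

end IsTraceOf

theorem Module.End.aeval_baseChange {R M : Type*} [CommRing R] [AddCommGroup M] [Module R M]
    (A : Type*) [CommRing A] [Algebra R A] {f : Module.End R M} {p : R[X]}
    (hf : aeval f p = 0) :
    aeval (LinearMap.baseChange A f : Module.End A (A ⊗[R] M)) (p.map (algebraMap R A)) = 0 := by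
  rw [aeval_map_algebraMap]
  have := aeval_algHom_apply (Module.End.baseChangeHom R A M) f p
  rw [hf, map_zero] at this
  exact this

theorem IsTraceOf.isIntegralOverRadical_algebraMap {R Q K P : Type*} [CommRing R] [CommRing Q]
    [Algebra R Q] [Field K] [Algebra R K] [Algebra Q K] [IsScalarTower R Q K] [AddCommGroup P]
    [Module Q P] [Module.Finite Q P] {I : Ideal R} {h : Module.End Q P} {t : Q}
    (ht : IsTraceOf h t) {p : R[X]} {N : ℕ} (hp : p.Monic)
    (hN : p.map (Ideal.Quotient.mk I) = X ^ N) (hh : aeval h (p.map (algebraMap R Q)) = 0) :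
    IsIntegralOverRadical I (algebraMap Q K t) := by
  let L := AlgebraicClosure K
  refine .of_algHom (IsScalarTower.toAlgHom R K L) (algebraMap K L).injective ?_
  have ht' := ((ht.baseChange K).baseChange L).trace_eq
  rw [IsScalarTower.coe_toAlgHom', ← ht']
  refine .trace hp hN ?_
  have := Module.End.aeval_baseChange L (Module.End.aeval_baseChange K hh)
  rwa [Polynomial.map_map, Polynomial.map_map, RingHom.comp_assoc, ← IsScalarTower.algebraMap_eq R Q K,
    ← IsScalarTower.algebraMap_eq R K L] at this

theorem Ideal.exists_minimalPrimes_le_of_disjoint_nonZeroDivisors {R : Type*} [CommRing R]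
    [IsNoetherianRing R] [IsReduced R] {I : Ideal R}
    (hI : Disjoint (nonZeroDivisors R : Set R) I) : ∃ q ∈ minimalPrimes R, I ≤ q := by
  have hsub : (I : Set R) ⊆ ⋃ q ∈ minimalPrimes R, (q : Set R) := fun x hx => by
    have hx' : x ∉ nonZeroDivisors R := fun hx' => Set.disjoint_left.mp hI hx' hx
    rw [mem_nonZeroDivisors_iff_right] at hx'
    push Not at hx'
    obtain ⟨y, hxy, hy⟩ := hx'
    have hbot : (⊥ : Ideal R).radical = ⊥ := nilradical_eq_zero R
    rw [minimalPrimes, Ideal.iUnion_minimalPrimes, hbot]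
    exact ⟨y, hy, by rwa [mul_comm]⟩
  exact (Ideal.subset_union_prime_finite (minimalPrimes.finite_of_isNoetherianRing R) ⊥ ⊥
    fun q hq _ _ => hq.1.1).mp hsub

theorem IsLocalization.isArtinianRing_of_isReduced (R Q : Type*) [CommRing R]
    [IsNoetherianRing R] [IsReduced R] [CommRing Q] [Algebra R Q]
    [IsLocalization (nonZeroDivisors R) Q] : IsArtinianRing Q := by
  have := IsLocalization.isNoetherianRing (nonZeroDivisors R) Q inferInstance
  rw [isArtinianRing_iff_krullDimLE_zero]
  refine .mk₀ fun P hP => ?_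
  obtain ⟨P', hP', hle⟩ := P.exists_le_maximal hP.ne_top
  have hdisj := ((IsLocalization.isPrime_iff_isPrime_disjoint (nonZeroDivisors R) Q P').mp
    hP'.isPrime).2
  obtain ⟨q, hq, hP'q⟩ := Ideal.exists_minimalPrimes_le_of_disjoint_nonZeroDivisors hdisj
  have hqP : q ≤ P.comap (algebraMap R Q) :=
    hq.2 ⟨hP.comap _, bot_le⟩ ((Ideal.comap_mono hle).trans hP'q)
  have : P' ≤ P := by
    rw [← IsLocalization.map_under (nonZeroDivisors R) Q P', Ideal.map_le_iff_le_comap]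
    exact hP'q.trans hqP
  rwa [le_antisymm hle this]

theorem Module.End.range_le_smul_top_of_mem_smul_top {R M : Type*} [CommRing R] [AddCommGroup M]
    [Module R M] {I : Ideal R} {f : Module.End R M}
    (hf : f ∈ I • (⊤ : Submodule R (Module.End R M))) :
    LinearMap.range f ≤ I • (⊤ : Submodule R M) := by
  rintro _ ⟨x, rfl⟩
  have := Submodule.mem_map_of_mem (f := LinearMap.applyₗ (R := R) (M₂ := M) x) hf
  rw [Submodule.map_smul''] at this
  exact (smul_mono_right I le_top : _ ≤ I • (⊤ : Submodule R M)) this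

theorem Module.End.exists_monic_aeval_eq_zero_of_pow_mem {R M : Type*} [CommRing R]
    [AddCommGroup M] [Module R M] [Module.Finite R M] {I : Ideal R} {h : Module.End R M} {n : ℕ}
    (hn : 0 < n) (hmem : h ^ n ∈ I • (⊤ : Submodule R (Module.End R M))) :
    ∃ (p : R[X]) (N : ℕ), p.Monic ∧ p.map (Ideal.Quotient.mk I) = X ^ N ∧ aeval h p = 0 := by
  obtain ⟨p, hp, -, hI, hx⟩ :=
    LinearMap.exists_monic_and_natDegree_eq_and_coeff_mem_pow_and_aeval_eq_zero R (h ^ n) I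
      (range_le_smul_top_of_mem_smul_top hmem)
  have hmap : p.map (Ideal.Quotient.mk I) = X ^ p.natDegree := hp.map_mk_eq_X_pow fun i hi => by
    obtain hi | hi := hi.lt_or_gt
    · exact Ideal.pow_le_self (by lia) (hI i)
    · simp [coeff_eq_zero_of_natDegree_lt hi]
  refine ⟨expand R n p, n * p.natDegree, hp.expand hn, ?_, by rwa [expand_aeval]⟩
  rw [map_expand, hmap, map_pow, expand_X, pow_mul]

/-- Let `R` be a reduced complete Noetherian local ring of Krull dimension one with maximal
ideal `m`, `Q = Q(R)` its total quotient ring, and `R̄ = integralClosure R Q`.  Let `M` be a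
finitely generated `R`-module and `h` an endomorphism of `M` with `h ^ n ∈ m • End_R(M)` for
some `n ≥ 1`.  Then `M ⊗[R] Q` is a finitely generated projective `Q`-module, and the trace
of `h ⊗[R] Q` lies in the Jacobson radical of `R̄`. -/
theorem trace_mem_jacobson_of_pow_mem
    (R : Type*) [CommRing R] [IsNoetherianRing R] [IsLocalRing R] [IsReduced R]
    [IsAdicComplete (IsLocalRing.maximalIdeal R) R]
    (hdim : ringKrullDim R = 1)
    (Q : Type*) [CommRing Q] [Algebra R Q] [IsLocalization (nonZeroDivisors R) Q]
    (M : Type*) [AddCommGroup M] [Module R M] [Module.Finite R M]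
    (h : Module.End R M) (n : ℕ) (hn : 1 ≤ n)
    (hmem : h ^ n ∈ (IsLocalRing.maximalIdeal R) • (⊤ : Submodule R (Module.End R M))) :
    Module.Finite Q (Q ⊗[R] M) ∧ Module.Projective Q (Q ⊗[R] M) ∧
      ∀ t : Q, IsTraceOf (LinearMap.baseChange Q (h : M →ₗ[R] M)) t →
        ∃ u : integralClosure R Q, (u : Q) = t ∧
          u ∈ Ideal.jacobson (⊥ : Ideal (integralClosure R Q)) := by
  have := IsLocalization.isArtinianRing_of_isReduced R Q
  have : IsReduced Q :=
    isReduced_of_injective _ (IsLocalization.algEquiv (nonZeroDivisors R) Q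
      (Localization (nonZeroDivisors R))).injective
  have := IsArtinianRing.isSemisimpleRing_of_isReduced Q
  refine ⟨inferInstance, Module.projective_of_isSemisimpleRing Q _, fun t ht => ?_⟩
  obtain ⟨p, N, hp, hN, hh⟩ := Module.End.exists_monic_aeval_eq_zero_of_pow_mem hn hmem
  have ht' : IsIntegralOverRadical (IsLocalRing.maximalIdeal R) t := by
    refine .of_forall_quotient_maximal (fun y hy => ?_) fun P => ?_
    · exact (IsArtinianRing.equivPi Q).injective (funext fun P => by
        simpa [Ideal.Quotient.eq_zero_iff_mem] using hy P)
    · have := P.isMaximal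
      let := Ideal.Quotient.field P.asIdeal
      exact ht.isIntegralOverRadical_algebraMap (K := Q ⧸ P.asIdeal) hp hN
        (Module.End.aeval_baseChange Q hh)
  refine ⟨⟨t, ht'.isIntegral⟩, rfl, IsIntegralOverRadical.mem_jacobson_bot (R := R) ?_⟩
  exact .of_algHom (integralClosure R Q).val Subtype.val_injective ht'
end

section
/- Let R be a one-dimensional Gorenstein Noetherian local ring with total quotient ring Q = Q(R), and let M be a finitely generated maximal Cohen-Macaulay R-module such that M ⊗_R Q is a projective Q-module. Then an endomorphism h ∈ End_R(M) factors through a projective R-module if and only if, for every g ∈ End_R(M), the trace of the endomorphism (g ∘ h) ⊗_R Q of M ⊗_R Q lies in the image of R in Q. -/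
open TensorProduct CategoryTheory CategoryTheory.Abelian

universe u

/-- The depth of a module `M` over a Noetherian local ring `R`: the supremum of the lengths
of `M`-regular sequences consisting of elements of the maximal ideal. -/
noncomputable def moduleDepth (R : Type*) [CommRing R] [IsLocalRing R]
    (M : Type*) [AddCommGroup M] [Module R M] : ℕ∞ :=
  ⨆ (rs : List R) (_ : RingTheory.Sequence.IsRegular M rs)
    (_ : ∀ r ∈ rs, r ∈ IsLocalRing.maximalIdeal R), (rs.length : ℕ∞)

/-- A Noetherian local ring `R` is Gorenstein if it is Cohen-Macaulay (`depth R = dim R`)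
and `Ext^{dim R}_R(k, R)` is one-dimensional over the residue field `k`; for
one-dimensional `R` the latter says that `Ext¹_R(k, R)` is nonzero and cyclic for the
action of `R` by composition (it is annihilated by the maximal ideal, so this means exactly
that it is a one-dimensional `k`-vector space). -/
def IsGorensteinOneDim (R : Type u) [CommRing R] [IsLocalRing R]
    [HasExt.{u} (ModuleCat.{u} R)] : Prop :=
  (moduleDepth R R : WithBot ℕ∞) = ringKrullDim R ∧
  ∃ e : Ext (ModuleCat.of R (IsLocalRing.ResidueField R)) (ModuleCat.of R R) 1, e ≠ 0 ∧
    ∀ e' : Ext (ModuleCat.of R (IsLocalRing.ResidueField R)) (ModuleCat.of R R) 1,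
      ∃ r : R, e' = e.comp (Ext.mk₀ (r • 𝟙 (ModuleCat.of R R))) (add_zero 1)

theorem Module.length_le_add_of_exact {R A B C : Type*} [Ring R] [AddCommGroup A] [Module R A]
    [AddCommGroup B] [Module R B] [AddCommGroup C] [Module R C] (f : A →ₗ[R] B) (g : B →ₗ[R] C)
    (hf : Function.Injective f) (hfg : Function.Exact f g) :
    Module.length R B ≤ Module.length R A + Module.length R C := by
  rw [Module.length_eq_add_of_exact f g.rangeRestrict hf g.surjective_rangeRestrict
    (by intro x; rw [← hfg x]; simp [Subtype.ext_iff])]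
  gcongr
  exact Module.length_le_of_injective _ (Submodule.injective_subtype _)

theorem Module.length_hom_le {R : Type*} [CommRing R] [IsLocalRing R] {T : Type*} [AddCommGroup T]
    [Module R T] (hT : Module.length R (IsLocalRing.ResidueField R →ₗ[R] T) ≤ 1)
    {N : Type*} [AddCommGroup N] [Module R N] (hN : IsFiniteLength R N) :
    Module.length R (N →ₗ[R] T) ≤ Module.length R N := by
  induction hN with
  | of_subsingleton => simp
  | @of_simple_quotient N _ _ S _ _ ih =>
    obtain ⟨I, hI, ⟨e⟩⟩ := isSimpleModule_iff_quot_maximal.mp ‹IsSimpleModule R (N ⧸ S)›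
    obtain rfl := IsLocalRing.eq_maximalIdeal hI
    have h1 : Module.length R ((N ⧸ S) →ₗ[R] T) ≤ 1 := by
      refine le_of_eq_of_le ?_ hT
      exact (LinearEquiv.congrLeft T R e).length_eq
    have h2 := Module.length_le_add_of_exact (LinearMap.lcomp R T S.mkQ)
      (LinearMap.lcomp R T S.subtype)
      (fun a b hab => by
        ext x; exact LinearMap.congr_fun hab x)
      (LinearMap.exact_lcomp_of_exact_of_surjective T (LinearMap.exact_subtype_mkQ S)
        S.mkQ_surjective)
    rw [Module.length_eq_add_of_exact S.subtype S.mkQ S.injective_subtype S.mkQ_surjective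
      (LinearMap.exact_subtype_mkQ S), Module.length_eq_one R (N ⧸ S), add_comm]
    exact h2.trans (add_le_add h1 ih)

theorem exists_hom_vanishing_of_notMem {R : Type*} [CommRing R] [IsLocalRing R] {T : Type*}
    [AddCommGroup T] [Module R T]
    (hT : Module.length R (IsLocalRing.ResidueField R →ₗ[R] T) ≤ 1)
    {N : Type*} [AddCommGroup N] [Module R N] (hN : IsFiniteLength R N)
    (hle : Module.length R N ≤ Module.length R (N →ₗ[R] T))
    (V : Submodule R N) {w : N} (hw : w ∉ V) :
    ∃ θ : N →ₗ[R] T, (∀ v ∈ V, θ v = 0) ∧ θ w ≠ 0 := by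
  by_contra! H
  have ⟨_, _⟩ := isFiniteLength_iff_isNoetherian_isArtinian.mp hN
  have fl (X : Submodule R N) : IsFiniteLength R X :=
    isFiniteLength_iff_isNoetherian_isArtinian.mpr ⟨inferInstance, inferInstance⟩
  set W := V ⊔ R ∙ w
  have hVW : V < W := by
    refine lt_of_le_of_ne le_sup_left fun h => hw ?_
    rw [h]
    exact Submodule.mem_sup_right (Submodule.mem_span_singleton_self w)
  have hlen : Module.length R V < Module.length R W := by
    rw [Module.length_submodule, Module.length_submodule]
    exact Submodule.height_strictMono hVW
  have hfl : IsFiniteLength R (N ⧸ W) :=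
    isFiniteLength_iff_isNoetherian_isArtinian.mpr ⟨inferInstance, inferInstance⟩
  have h2 := Module.length_le_add_of_exact (LinearMap.lcomp R T W.mkQ)
      (LinearMap.lcomp R T V.subtype)
      (fun a b hab => by
        ext x; exact LinearMap.congr_fun hab x)
      (by
        intro θ
        constructor
        · intro h
          have hV : ∀ v ∈ V, θ v = 0 := fun v hv => LinearMap.congr_fun h ⟨v, hv⟩
          have hWk : W ≤ LinearMap.ker θ :=
            sup_le hV ((Submodule.span_singleton_le_iff_mem _ _).2 (H θ hV))
          exact ⟨W.liftQ θ hWk, by ext; simp⟩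
        · rintro ⟨ψ, rfl⟩
          ext v
          have : W.mkQ (v : N) = 0 := by simpa using hVW.le v.2
          rw [LinearMap.lcomp_apply, LinearMap.lcomp_apply, Submodule.subtype_apply, this, map_zero]
          rfl)
  have h3 := Module.length_eq_add_of_exact W.subtype W.mkQ W.injective_subtype W.mkQ_surjective
    (LinearMap.exact_subtype_mkQ W)
  have h4 := Module.length_hom_le hT hfl
  have h5 := Module.length_hom_le hT (fl V)
  have h6 : Module.length R (N ⧸ W) ≠ ⊤ := Module.length_ne_top_iff.2 hfl
  have h7 : Module.length R (N ⧸ W) + Module.length R V <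
      Module.length R W + Module.length R (N ⧸ W) := by
    rw [add_comm]
    exact (ENat.add_lt_add_iff_right h6).2 hlen
  rw [← h3] at h7
  exact absurd (hle.trans (h2.trans (add_le_add h4 h5))) (not_le.2 h7)

theorem LinearMap.exists_eq_smul_of_forall_mem {R A B : Type*} [CommRing R] [AddCommGroup A]
    [Module R A] [AddCommGroup B] [Module R B] {c : R} (hc : IsSMulRegular B c) (f : A →ₗ[R] B)
    (hf : ∀ x, ∃ y, f x = c • y) : ∃ g : A →ₗ[R] B, ∀ x, f x = c • g x := by
  choose g hg using hf
  refine ⟨⟨⟨g, fun x y => hc ?_⟩, fun r x => hc ?_⟩, hg⟩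
  · simp [← hg, smul_add]
  · simp [← hg, smul_comm c r]

/-- Over a local ring whose quotients by nonzerodivisors are Artinian with socle of length at most
one, elements of a submodule of a finite free module are separated modulo nonzerodivisors by linear forms. -/
theorem exists_linearForm_notMem {R : Type*} [CommRing R] [IsNoetherianRing R] [IsLocalRing R]
    (hart : ∀ t ∈ IsLocalRing.maximalIdeal R, t ∈ nonZeroDivisors R →
      IsArtinianRing (R ⧸ Ideal.span {t}))
    (htype : ∀ t ∈ IsLocalRing.maximalIdeal R, t ∈ nonZeroDivisors R →
      Module.length R (IsLocalRing.ResidueField R →ₗ[R] (R ⧸ Ideal.span {t})) ≤ 1)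
    {L : Type*} [AddCommGroup L] [Module R L] {ι : Type*} [Finite ι] (j : L →ₗ[R] (ι → R))
    (hj : Function.Injective j) {c : R} (hc : c ∈ nonZeroDivisors R) {w : L}
    (hw : ∀ l, w ≠ c • l) : ∃ φ : L →ₗ[R] R, ∀ r, φ w ≠ c * r := by
  classical
  have := Fintype.ofFinite ι
  have hcm : c ∈ IsLocalRing.maximalIdeal R := by
    rw [IsLocalRing.mem_maximalIdeal, mem_nonunits_iff]
    rintro ⟨u, rfl⟩
    exact hw ((u⁻¹ : Rˣ) • w) (by simp [← Units.smul_def])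
  obtain ⟨k, hk⟩ := Ideal.exists_pow_inf_eq_pow_smul (Ideal.span {c}) (LinearMap.range j)
  have hAR : ∀ (l : L) (y : ι → R), j l = c ^ (k + 1) • y → ∃ l', l = c • l' := by
    intro l y hy
    have h1 : j l ∈ Ideal.span {c} ^ (k + 1) • (⊤ : Submodule R (ι → R)) ⊓ LinearMap.range j := by
      refine ⟨?_, l, rfl⟩
      rw [hy]
      exact Submodule.smul_mem_smul (Ideal.pow_mem_pow (Ideal.mem_span_singleton_self c) _) trivial
    rw [hk (k + 1) (by omega)] at h1
    simp only [add_tsub_cancel_left, pow_one, Submodule.ideal_span_singleton_smul] at h1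
    obtain ⟨z, ⟨-, l', rfl⟩, hz⟩ := h1
    refine ⟨l', hj ?_⟩
    rw [map_smul, ← hz]; rfl
  set t := c ^ (k + 1) with ht
  have htm : t ∈ IsLocalRing.maximalIdeal R := Ideal.pow_mem_of_mem _ hcm _ (by omega)
  have htn : t ∈ nonZeroDivisors R := pow_mem hc _
  let T := R ⧸ Ideal.span {t}
  have : IsArtinianRing T := hart t htm htn
  have : IsArtinian R T := isArtinian_of_surjective_algebraMap (S := R) (R := T)
    Ideal.Quotient.mk_surjective
  let π : (ι → R) →ₗ[R] (ι → T) := (Algebra.linearMap R T).compLeft ι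
  have hπ : ∀ x, π x = 0 → ∃ y, x = t • y := by
    intro x hx
    have : ∀ i, ∃ y, x i = t * y := fun i => by
      have := congr_fun hx i
      exact Ideal.mem_span_singleton'.1 (Ideal.Quotient.eq_zero_iff_mem.1 this) |>.imp fun a h =>
        by simpa [mul_comm] using h.symm
    choose y hy using this
    exact ⟨y, funext hy⟩
  let V : Submodule R (ι → T) := LinearMap.range (c • (π ∘ₗ j))
  have hwV : π (j w) ∉ V := by
    rintro ⟨l, hl⟩
    obtain ⟨y, hy⟩ := hπ (j (w - c • l)) (by simp [← hl])
    obtain ⟨l', hl'⟩ := hAR _ _ hy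
    exact hw (l + l') (by rw [smul_add, ← hl']; abel)
  have hle : Module.length R (ι → T) ≤ Module.length R ((ι → T) →ₗ[R] T) := by
    let D : (ι → T) →ₗ[R] ((ι → T) →ₗ[R] T) :=
      LinearMap.mk₂ R (fun a x => ∑ i, a i * x i) (by simp [add_mul, Finset.sum_add_distrib])
        (by simp [Finset.smul_sum]) (by simp [mul_add, Finset.sum_add_distrib])
        (by simp [Finset.smul_sum])
    refine Module.length_le_of_injective D ?_
    intro a b hab
    ext i
    simpa [D, Pi.single_apply] using LinearMap.congr_fun hab (Pi.single i 1)
  obtain ⟨θ, hθV, hθw⟩ := exists_hom_vanishing_of_notMem (htype t htm htn)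
    (isFiniteLength_iff_isNoetherian_isArtinian.mpr ⟨inferInstance, inferInstance⟩) hle V hwV
  obtain ⟨Θ, hΘ⟩ := Module.projective_lifting_property (Algebra.linearMap R T) (θ ∘ₗ π)
    Ideal.Quotient.mk_surjective
  have hΘ' : ∀ x, θ (π x) = Ideal.Quotient.mk _ (Θ x) := fun x => (LinearMap.congr_fun hΘ x).symm
  have hreg : IsSMulRegular R (c ^ k) :=
    (isRegular_iff_mem_nonZeroDivisors.2 (pow_mem hc k)).left
  obtain ⟨φ, hφ⟩ := LinearMap.exists_eq_smul_of_forall_mem hreg (Θ ∘ₗ j) (by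
    intro l
    have h0 : θ (π (j (c • l))) = 0 := hθV _ ⟨l, by simp⟩
    rw [hΘ', Ideal.Quotient.eq_zero_iff_mem, Ideal.mem_span_singleton'] at h0
    obtain ⟨a, ha⟩ := h0
    refine ⟨a, (isRegular_iff_mem_nonZeroDivisors.2 hc).left ?_⟩
    simp only [map_smul, smul_eq_mul, LinearMap.comp_apply] at ha ⊢
    rw [← ha, ht]; ring)
  refine ⟨φ, fun r hr => hθw ?_⟩
  rw [hΘ', Ideal.Quotient.eq_zero_iff_mem, Ideal.mem_span_singleton']
  refine ⟨r, ?_⟩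
  have := hφ w
  simp only [LinearMap.comp_apply] at this
  rw [this, hr, ht, smul_eq_mul]; ring

theorem length_hom_residueField_quotient_le {R : Type u} [CommRing R] [IsLocalRing R]
    [HasExt.{u} (ModuleCat.{u} R)]
    (e : Ext (ModuleCat.of R (IsLocalRing.ResidueField R)) (ModuleCat.of R R) 1)
    (he : ∀ e' : Ext (ModuleCat.of R (IsLocalRing.ResidueField R)) (ModuleCat.of R R) 1,
      ∃ r : R, e' = e.comp (Ext.mk₀ (r • 𝟙 (ModuleCat.of R R))) (add_zero 1))
    {t : R} (htm : t ∈ IsLocalRing.maximalIdeal R) (htn : t ∈ nonZeroDivisors R) :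
    Module.length R (IsLocalRing.ResidueField R →ₗ[R] (R ⧸ Ideal.span {t})) ≤ 1 := by
  have hk : ∀ r ∈ IsLocalRing.maximalIdeal R, ∀ x : IsLocalRing.ResidueField R, r • x = 0 := by
    intro r hr x
    rw [Algebra.smul_def, IsLocalRing.ResidueField.algebraMap_eq,
      (IsLocalRing.residue_eq_zero_iff r).2 hr, zero_mul]
  have hreg := (isRegular_iff_mem_nonZeroDivisors.2 htn).left
  let E := Ext (ModuleCat.of R (IsLocalRing.ResidueField R)) (ModuleCat.of R R) 1
  have hE : Module.length R E ≤ 1 := by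
    have hann : IsLocalRing.maximalIdeal R ≤ LinearMap.ker (LinearMap.toSpanSingleton R E e) := by
      intro r hr
      have h0 : r • 𝟙 (ModuleCat.of R (IsLocalRing.ResidueField R)) = 0 := by
        ext x
        exact hk r hr x
      have : r • e = 0 := by
        rw [← Ext.mk₀_id_comp e, ← Ext.smul_comp, ← Ext.mk₀_smul, h0]
        simp
      simpa using this
    have hs : IsSimpleModule R (R ⧸ IsLocalRing.maximalIdeal R) :=
      isSimpleModule_iff_quot_maximal.2 ⟨_, inferInstance, ⟨LinearEquiv.refl _ _⟩⟩
    rw [← Module.length_eq_one R (R ⧸ IsLocalRing.maximalIdeal R)]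
    refine Module.length_le_of_surjective (Submodule.liftQ _ _ hann) ?_
    intro e'
    obtain ⟨r, hr⟩ := he e'
    refine ⟨Submodule.Quotient.mk r, ?_⟩
    rw [Submodule.liftQ_apply, hr, ← Ext.smul_eq_comp_mk₀]
    simp
  let S : ShortComplex (ModuleCat.{u} R) := ShortComplex.mk
    (ModuleCat.ofHom (t • LinearMap.id : R →ₗ[R] R))
    (ModuleCat.ofHom (Submodule.mkQ (Ideal.span {t}))) (by
      ext
      simp)
  have hS : S.ShortExact :=
    { exact := by
        rw [ShortComplex.moduleCat_exact_iff]
        intro x hx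
        obtain ⟨a, ha⟩ := Ideal.mem_span_singleton'.1 ((Submodule.Quotient.mk_eq_zero _).1 hx)
        exact ⟨a, by rw [← ha, mul_comm]; rfl⟩
      mono_f := by
        rw [ModuleCat.mono_iff_injective]
        exact hreg
      epi_g := by
        rw [ModuleCat.epi_iff_surjective]
        exact Submodule.mkQ_surjective _ }
  let δ : (IsLocalRing.ResidueField R →ₗ[R] (R ⧸ Ideal.span {t})) →ₗ[R] E :=
    { toFun f := (Ext.mk₀ (ModuleCat.ofHom f : _ ⟶ S.X₃)).comp hS.extClass (zero_add 1)
      map_add' f g := by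
        rw [← Ext.add_comp, ← Ext.mk₀_add]; rfl
      map_smul' r f := by
        rw [RingHom.id_apply, ← Ext.smul_comp, ← Ext.mk₀_smul]; rfl }
  refine (Module.length_le_of_injective δ ?_).trans hE
  rw [injective_iff_map_eq_zero]
  intro f hf
  obtain ⟨x₂, hx₂⟩ := Ext.covariant_sequence_exact₃ _ hS _ (zero_add 1) hf
  obtain ⟨g, rfl⟩ := Ext.mk₀_bijective _ _ |>.2 x₂
  have hg : g = 0 := by
    ext x
    refine hreg ?_
    change t • g.hom x = t • (0 : R)
    rw [← map_smul, hk t htm, map_zero, smul_zero]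
  subst hg
  rw [Ext.mk₀_comp_mk₀, Limits.zero_comp] at hx₂
  have := (Ext.mk₀_bijective _ _).1 hx₂
  ext x
  exact LinearMap.congr_fun (congr_arg ModuleCat.Hom.hom this.symm) x

theorem exists_isSMulRegular_of_moduleDepth_eq_one {R : Type*} [CommRing R] [IsLocalRing R]
    {M : Type*} [AddCommGroup M] [Module R M] (h : moduleDepth R M = 1) :
    ∃ x ∈ IsLocalRing.maximalIdeal R, IsSMulRegular M x := by
  have h0 : 0 < moduleDepth R M := by simp [h]
  simp only [moduleDepth, lt_iSup_iff] at h0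
  obtain ⟨rs, hrs, hm, hlen⟩ := h0
  cases rs with
  | nil => simp at hlen
  | cons x rs =>
    exact ⟨x, hm x (by simp), ((RingTheory.Sequence.isWeaklyRegular_cons_iff _ _ _).1 hrs.1).1⟩

theorem isArtinianRing_quotient_span_singleton {R : Type*} [CommRing R] [IsNoetherianRing R]
    (hdim : ringKrullDim R ≤ 1) {t : R} (ht : t ∈ nonZeroDivisors R) :
    IsArtinianRing (R ⧸ Ideal.span {t}) := by
  rw [isArtinianRing_iff_krullDimLE_zero, Ring.KrullDimLE, Order.krullDimLE_iff, ← ringKrullDim]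
  have h := (ringKrullDim_quotient_succ_le_of_nonZeroDivisor ht).trans hdim
  generalize ringKrullDim (R ⧸ Ideal.span {t}) = d at h
  induction d with
  | bot => simp
  | coe d =>
    norm_cast at h ⊢
    induction d with
    | top => simp at h
    | coe d => norm_cast at h ⊢; omega

theorem isSMulRegular_of_mem_nonZeroDivisors {R : Type*} [CommRing R] [IsNoetherianRing R]
    [IsLocalRing R] (hdim : ringKrullDim R ≤ 1) {M : Type*} [AddCommGroup M] [Module R M] {x : R}
    (hxm : x ∈ IsLocalRing.maximalIdeal R) (hx : IsSMulRegular M x) {t : R}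
    (ht : t ∈ nonZeroDivisors R) : IsSMulRegular M t := by
  by_cases htu : IsUnit t
  · exact htu.isSMulRegular M
  have := isArtinianRing_quotient_span_singleton hdim ht
  have htop : Ideal.span {t} ≠ ⊤ := by rwa [Ne, Ideal.span_singleton_eq_top]
  have : Nontrivial (R ⧸ Ideal.span {t}) := Ideal.Quotient.nontrivial_iff.mpr htop
  have : IsLocalRing (R ⧸ Ideal.span {t}) := .of_surjective' _ Ideal.Quotient.mk_surjective
  have hnil : IsNilpotent (Ideal.Quotient.mk (Ideal.span {t}) x) := by
    obtain ⟨n, hn⟩ := IsArtinianRing.isNilpotent_jacobson_bot (R := R ⧸ Ideal.span {t})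
    refine ⟨n, ?_⟩
    have : Ideal.Quotient.mk (Ideal.span {t}) x ∈ Ideal.jacobson ⊥ := by
      rw [IsLocalRing.jacobson_eq_maximalIdeal _ bot_ne_top, IsLocalRing.mem_maximalIdeal,
        mem_nonunits_iff]
      intro hu
      obtain ⟨y, hy⟩ := Ideal.Quotient.mk_surjective hu.unit⁻¹.val
      have h1 : Ideal.Quotient.mk (Ideal.span {t}) (x * y - 1) = 0 := by
        rw [map_sub, map_mul, hy, IsUnit.mul_val_inv, map_one, sub_self]
      rw [Ideal.Quotient.eq_zero_iff_mem] at h1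
      have h2 := (Ideal.span_singleton_le_iff_mem _).2 ((IsLocalRing.mem_maximalIdeal t).2 htu) h1
      refine (Ideal.ne_top_iff_one _).1 (IsLocalRing.maximalIdeal.isMaximal R).ne_top ?_
      simpa using sub_mem (Ideal.mul_mem_right y _ hxm) h2
    have := Ideal.pow_mem_pow this n
    rwa [hn, Ideal.zero_eq_bot, Ideal.mem_bot] at this
  obtain ⟨n, hn⟩ := hnil
  rw [← map_pow, Ideal.Quotient.eq_zero_iff_mem, Ideal.mem_span_singleton'] at hn
  obtain ⟨a, ha⟩ := hn
  have := hx.pow n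
  rw [← ha] at this
  exact this.of_mul

theorem exists_smul_eq_sum_of_projective_baseChange {R : Type*} [CommRing R]
    (Q : Type*) [CommRing Q] [Algebra R Q] [IsLocalization (nonZeroDivisors R) Q]
    (M : Type*) [AddCommGroup M] [Module R M] [Module.Finite R M]
    (hreg : ∀ t ∈ nonZeroDivisors R, IsSMulRegular M t)
    [Module.Projective Q (Q ⊗[R] M)] :
    ∃ (n : ℕ) (e : Fin n → M) (φ : Fin n → (M →ₗ[R] R)) (c : R), c ∈ nonZeroDivisors R ∧
      ∀ y, c • y = ∑ i, φ i y • e i := by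
  obtain ⟨n, π, hπ⟩ := Module.Finite.exists_fin' R M
  let e : Fin n → M := fun i => π (Pi.single i 1)
  have hπe : ∀ x, π x = ∑ i, x i • e i := fun x => by
    conv_lhs => rw [pi_eq_sum_univ' x]
    simp [e]
  let p : (Fin n → Q) →ₗ[Q] Q ⊗[R] M := Fintype.linearCombination Q (fun i => (1 : Q) ⊗ₜ[R] e i)
  have hp : Function.Surjective p := by
    rw [← LinearMap.range_eq_top, eq_top_iff]
    rintro z -
    induction z with
    | zero => exact zero_mem _
    | add x y hx hy => exact add_mem hx hy
    | tmul q m =>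
      obtain ⟨x, rfl⟩ := hπ m
      refine ⟨fun i => q * algebraMap R Q (x i), ?_⟩
      simp only [p, Fintype.linearCombination_apply, hπe, TensorProduct.tmul_sum,
        TensorProduct.smul_tmul', smul_eq_mul, mul_one]
      refine Finset.sum_congr rfl fun i _ => ?_
      rw [← TensorProduct.smul_tmul, Algebra.smul_def, mul_comm]
  obtain ⟨σ, hσ⟩ := Module.projective_lifting_property p LinearMap.id hp
  obtain ⟨b, hb⟩ := IsLocalization.exist_integer_multiples_of_finite (nonZeroDivisors R)
    (fun k : Fin n × Fin n => σ (1 ⊗ₜ e k.1) k.2)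
  have hinj : Function.Injective (algebraMap R Q) :=
    IsLocalization.injective Q le_rfl
  let ρ : Fin n → M →ₗ[R] Q := fun i => (b : R) •
    ((LinearMap.proj i ∘ₗ σ).restrictScalars R ∘ₗ TensorProduct.mk R Q M 1)
  have hρ : ∀ i y, ρ i y ∈ LinearMap.range (Algebra.linearMap R Q) := by
    intro i y
    obtain ⟨x, rfl⟩ := hπ y
    rw [hπe, map_sum]
    refine sum_mem fun k _ => ?_
    rw [map_smul]
    refine Submodule.smul_mem _ _ ?_
    obtain ⟨r, hr⟩ := hb (k, i)
    exact ⟨r, hr⟩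
  let φ : Fin n → M →ₗ[R] R := fun i =>
    (LinearEquiv.ofInjective (Algebra.linearMap R Q) hinj).symm.toLinearMap ∘ₗ
      (ρ i).codRestrict _ (hρ i)
  have hφ : ∀ i y, algebraMap R Q (φ i y) = (b : R) • σ (1 ⊗ₜ y) i := by
    intro i y
    exact congr_arg Subtype.val (LinearEquiv.apply_symm_apply
      (LinearEquiv.ofInjective (Algebra.linearMap R Q) hinj) ((ρ i).codRestrict _ (hρ i) y))
  refine ⟨n, e, φ, b, b.2, fun y => ?_⟩
  have h1 : TensorProduct.mk R Q M 1 ((b : R) • y) =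
      TensorProduct.mk R Q M 1 (∑ i, φ i y • e i) := by
    have := LinearMap.congr_fun hσ (1 ⊗ₜ y)
    simp only [LinearMap.comp_apply, LinearMap.id_apply, p, Fintype.linearCombination_apply] at this
    rw [map_smul, TensorProduct.mk_apply, ← this, Finset.smul_sum, map_sum]
    refine Finset.sum_congr rfl fun i _ => ?_
    rw [← smul_assoc, ← hφ, algebraMap_smul, map_smul]; rfl
  obtain ⟨s, hs⟩ := (IsLocalizedModule.eq_iff_exists (nonZeroDivisors R)
    (TensorProduct.mk R Q M 1)).1 h1
  exact hreg s s.2 hs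

theorem isTraceOf_baseChange_of_smul_eq_sum {R : Type*} [CommRing R]
    (Q : Type*) [CommRing Q] [Algebra R Q]
    {M : Type*} [AddCommGroup M] [Module R M] {n : ℕ} {e : Fin n → M} {φ : Fin n → (M →ₗ[R] R)}
    {c : R} {q : Q} (hq : q * algebraMap R Q c = 1) (h : ∀ y, c • y = ∑ i, φ i y • e i)
    (f : M →ₗ[R] M) :
    IsTraceOf (LinearMap.baseChange Q f) (q * algebraMap R Q (∑ i, φ i (f (e i)))) := by
  refine ⟨n, fun i => 1 ⊗ₜ e i,
    fun i => q • LinearMap.liftBaseChange Q (Algebra.linearMap R Q ∘ₗ φ i), fun y => ?_, ?_⟩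
  · induction y with
    | zero => simp
    | add x y hx hy =>
      simp only [map_add, add_smul, Finset.sum_add_distrib]
      rw [← hx, ← hy]
    | tmul a m =>
      have h1 : a ⊗ₜ[R] m = (q * a) ⊗ₜ[R] (c • m) := by
        rw [← TensorProduct.smul_tmul, Algebra.smul_def, ← mul_assoc, mul_comm _ q, hq, one_mul]
      conv_lhs => rw [h1, h, TensorProduct.tmul_sum]
      refine Finset.sum_congr rfl fun i _ => ?_
      rw [← TensorProduct.smul_tmul, TensorProduct.smul_tmul', Algebra.smul_def]
      congr 1
      simp
      ring
  · simp [Finset.mul_sum]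

theorem IsTraceOf.eq_sum_of_forall_eq_sum {R : Type*} [CommRing R]
    {Q : Type*} [CommRing Q] [Algebra R Q]
    {M : Type*} [AddCommGroup M] [Module R M] {n : ℕ} {m : Fin n → M} {ψ : Fin n → (M →ₗ[R] R)}
    {f : M →ₗ[R] M} (hf : ∀ y, f y = ∑ i, ψ i y • m i) {t : Q}
    (ht : IsTraceOf (LinearMap.baseChange Q f) t) :
    t = algebraMap R Q (∑ i, ψ i (m i)) := by
  obtain ⟨k, e, φ, he, rfl⟩ := ht
  let Ψ : Fin n → (Q ⊗[R] M →ₗ[Q] Q) := fun i =>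
    LinearMap.liftBaseChange Q (Algebra.linearMap R Q ∘ₗ ψ i)
  have hΨ : ∀ z, LinearMap.baseChange Q f z = ∑ i, Ψ i z • (1 ⊗ₜ[R] m i) := by
    intro z
    induction z with
    | zero => simp
    | add x y hx hy => simp only [map_add, add_smul, Finset.sum_add_distrib, hx, hy]
    | tmul a y =>
      rw [LinearMap.baseChange_tmul, hf, TensorProduct.tmul_sum]
      refine Finset.sum_congr rfl fun i _ => ?_
      rw [← TensorProduct.smul_tmul, TensorProduct.smul_tmul', Algebra.smul_def]
      congr 1
      simp [Ψ, mul_comm]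
  simp only [hΨ, map_sum, map_smul, smul_eq_mul]
  rw [Finset.sum_comm]
  refine Finset.sum_congr rfl fun i _ => ?_
  have h1 : Ψ i (1 ⊗ₜ[R] m i) = algebraMap R Q (ψ i (m i)) := by simp [Ψ]
  rw [← h1]
  conv_rhs => rw [he (1 ⊗ₜ[R] m i)]
  simp [mul_comm]


/-- If `(eᵢ, φᵢ)` is a dual family of `M` up to the nonzerodivisor `c`, an endomorphism `h` with
all `∑ φᵢ (g (h eᵢ))` divisible by `c` factors through a finite free module. -/
theorem exists_eq_comp_of_dvd_sum {R : Type*} [CommRing R] [IsNoetherianRing R] [IsLocalRing R]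
    (hart : ∀ t ∈ IsLocalRing.maximalIdeal R, t ∈ nonZeroDivisors R →
      IsArtinianRing (R ⧸ Ideal.span {t}))
    (htype : ∀ t ∈ IsLocalRing.maximalIdeal R, t ∈ nonZeroDivisors R →
      Module.length R (IsLocalRing.ResidueField R →ₗ[R] (R ⧸ Ideal.span {t})) ≤ 1)
    {M : Type*} [AddCommGroup M] [Module R M] {c : R}
    (hc : c ∈ nonZeroDivisors R) (hcM : IsSMulRegular M c) {n : ℕ} {e : Fin n → M}
    {φ : Fin n → (M →ₗ[R] R)} (hφ : ∀ y, c • y = ∑ i, φ i y • e i)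
    {k : ℕ} (π : (Fin k → R) →ₗ[R] M) (hπ : Function.Surjective π) (h : M →ₗ[R] M)
    (hh : ∀ g : M →ₗ[R] M, c ∣ ∑ i, φ i (g (h (e i)))) :
    ∃ a : M →ₗ[R] (Fin k → R), h = π ∘ₗ a := by
  let I : Submodule R (M →ₗ[R] M) := LinearMap.range (LinearMap.compRight R (M := M) π)
  suffices hI : h ∈ I by
    obtain ⟨a, rfl⟩ := hI
    exact ⟨a, rfl⟩
  by_contra hI
  have hcR := (isRegular_iff_mem_nonZeroDivisors.2 hc).left
  have hmem : ∀ (ψ : M →ₗ[R] R) (m : M), ψ.smulRight m ∈ I := by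
    intro ψ m
    obtain ⟨x, rfl⟩ := hπ m
    exact ⟨ψ.smulRight x, by ext y; simp⟩
  let τ : (M →ₗ[R] R) →ₗ[R] M →ₗ[R] I :=
    LinearMap.mk₂ R (fun ψ m => ⟨ψ.smulRight m, hmem ψ m⟩)
      (fun _ _ _ => by ext; simp [add_smul]) (fun _ _ _ => by ext; simp [mul_smul])
      (fun _ _ _ => by ext; simp) (fun _ _ _ => by ext; exact smul_comm _ _ _)
  have hτ : ∀ f : M →ₗ[R] M, c • f = ∑ i, (τ (φ i) (f (e i)) : M →ₗ[R] M) := by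
    intro f
    ext y
    have := congr_arg f (hφ y)
    simpa [τ, map_sum] using this
  let J : I →ₗ[R] (Fin n × Fin n → R) :=
    LinearMap.pi fun p => φ p.1 ∘ₗ LinearMap.applyₗ (e p.2) ∘ₗ I.subtype
  have hφ₀ : ∀ y, (∀ i, φ i y = 0) → y = 0 := fun y hy => hcM <| by
    simp [hφ y, hy]
  have hJ : Function.Injective J := by
    rw [injective_iff_map_eq_zero]
    intro f hf
    have h1 : ∀ i, (f : M →ₗ[R] M) (e i) = 0 := fun i =>
      hφ₀ _ fun j => congr_fun hf (j, i)
    ext y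
    refine hcM ?_
    have h2 := LinearMap.congr_fun (hτ f) y
    simpa [h1] using h2
  obtain ⟨Φ, hΦ⟩ := exists_linearForm_notMem hart htype J hJ hc
    (w := ∑ i, τ (φ i) (h (e i))) (by
      intro l hl
      refine hI ?_
      have h1 : c • h = c • (l : M →ₗ[R] M) := by
        rw [hτ h]; simpa using congr_arg Subtype.val hl
      have h2 : h = l := by
        ext y
        exact hcM (LinearMap.congr_fun h1 y)
      rw [h2]
      exact l.2)
  let u : M →ₗ[R] M := ∑ i, (Φ ∘ₗ τ (φ i)).smulRight (e i)
  have hu : ∀ (ψ : M →ₗ[R] R) m, ψ (u m) = c * Φ (τ ψ m) := by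
    intro ψ m
    have h1 : c • ψ = ∑ i, ψ (e i) • φ i := by
      ext y
      have := congr_arg ψ (hφ y)
      simpa [map_sum, mul_comm] using this
    rw [← smul_eq_mul, ← map_smul, ← LinearMap.smul_apply, ← map_smul, h1]
    simp [u, map_sum, mul_comm]
  have hdiv : ∀ m, ∃ y, u m = c • y := by
    intro m
    by_contra! hne
    obtain ⟨ψ, hψ⟩ := exists_linearForm_notMem hart htype (LinearMap.pi φ) (by
      rw [injective_iff_map_eq_zero]
      exact fun y hy => hφ₀ y (congr_fun hy)) hc hne
    exact hψ _ (hu ψ m)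
  obtain ⟨g, hg⟩ := LinearMap.exists_eq_smul_of_forall_mem hcM u hdiv
  have hgΦ : ∀ i m, φ i (g m) = Φ (τ (φ i) m) := fun i m => hcR <| by
    simp [← hu, hg]
  obtain ⟨r, hr⟩ := hh g
  refine hΦ r ?_
  rw [← hr, map_sum]
  exact Finset.sum_congr rfl fun i _ => (hgΦ i _).symm

/-- Let `R` be a one-dimensional Gorenstein Noetherian local ring with total quotient ring
`Q`, and `M` a finitely generated maximal Cohen-Macaulay `R`-module with `M ⊗[R] Q`
projective over `Q`.  An endomorphism `h` of `M` factors through a projective `R`-module if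
and only if for every `g ∈ End_R(M)` the trace of `(g ∘ h) ⊗[R] Q` lies in the image of `R`
in `Q`. -/
theorem stablyZero_iff_traces_in_R
    (R : Type u) [CommRing R] [IsNoetherianRing R] [IsLocalRing R]
    [HasExt.{u} (ModuleCat.{u} R)]
    (hdim : ringKrullDim R = 1) (hGor : IsGorensteinOneDim R)
    (Q : Type*) [CommRing Q] [Algebra R Q] [IsLocalization (nonZeroDivisors R) Q]
    (M : Type u) [AddCommGroup M] [Module R M] [Module.Finite R M]
    (hMCM : (moduleDepth R M : WithBot ℕ∞) = ringKrullDim R)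
    (hproj : Module.Projective Q (Q ⊗[R] M))
    (h : Module.End R M) :
    (∃ (P : Type u) (_ : AddCommGroup P) (_ : Module R P), Module.Projective R P ∧
        ∃ (a : M →ₗ[R] P) (b : P →ₗ[R] M), (h : M →ₗ[R] M) = b ∘ₗ a) ↔
      ∀ (g : Module.End R M) (t : Q),
        IsTraceOf (LinearMap.baseChange Q ((g ∘ₗ h : Module.End R M) : M →ₗ[R] M)) t →
          t ∈ (algebraMap R Q).range := by
  have hdepth (N : Type u) [AddCommGroup N] [Module R N]
      (hN : (moduleDepth R N : WithBot ℕ∞) = ringKrullDim R) : moduleDepth R N = 1 := by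
    rw [hdim] at hN
    exact_mod_cast hN
  obtain ⟨x, hxm, hxM⟩ := exists_isSMulRegular_of_moduleDepth_eq_one (hdepth M hMCM)
  have hreg : ∀ t ∈ nonZeroDivisors R, IsSMulRegular M t := fun t ht =>
    isSMulRegular_of_mem_nonZeroDivisors hdim.le hxm hxM ht
  obtain ⟨k, π, hπ⟩ := Module.Finite.exists_fin' R M
  constructor
  · rintro ⟨P, _, _, hP, a, b, rfl⟩ g t ht
    obtain ⟨b', rfl⟩ := Module.projective_lifting_property π b hπ
    refine ⟨_, (IsTraceOf.eq_sum_of_forall_eq_sum (m := fun i => g (π (Pi.single i 1)))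
      (ψ := fun i => LinearMap.proj i ∘ₗ b' ∘ₗ a) (fun y => ?_) ht).symm⟩
    simp only [LinearMap.comp_apply]
    conv_lhs => rw [pi_eq_sum_univ' (b' (a y))]
    simp
  · intro H
    obtain ⟨-, e, -, he⟩ := hGor
    obtain ⟨n, v, φ, c, hc, hφ⟩ := exists_smul_eq_sum_of_projective_baseChange Q M hreg
    obtain ⟨a, ha⟩ := exists_eq_comp_of_dvd_sum
      (fun t _ ht => isArtinianRing_quotient_span_singleton hdim.le ht)
      (fun t htm ht => length_hom_residueField_quotient_le e he htm ht)
      hc (hreg c hc) hφ π hπ h (fun g => by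
        have hq : IsLocalization.mk' Q 1 (⟨c, hc⟩ : nonZeroDivisors R) * algebraMap R Q c = 1 := by
          simp
        obtain ⟨r, hr⟩ := H g _ (isTraceOf_baseChange_of_smul_eq_sum Q hq hφ (g ∘ₗ h))
        refine ⟨r, IsLocalization.injective Q (M := nonZeroDivisors R) le_rfl ?_⟩
        rw [map_mul, hr, ← mul_assoc, mul_comm (algebraMap R Q c), hq, one_mul]
        rfl)
    exact ⟨Fin k → R, inferInstance, inferInstance, inferInstance, a, π, ha⟩
end

section
/- Let R be a one-dimensional Gorenstein complete Noetherian local ring, 𝔭 a minimal prime of R, R' = R/𝔭, Q = Q(R), Q' = Q(R'), and let π : Q → Q' be the canonical surjection obtained from the R-algebra isomorphism Q/𝔭Q ≅ Q'. Let γ̃' ∈ Q be an element such that γ' := π(γ̃') satisfies γ'·m_{R̄'} ⊆ R' and γ' ∉ R', where R̄' is the integral closure of the complete local domain R' in Q' (a discrete valuation ring with maximal ideal m_{R̄'}). Then there exists z ∈ R such that Ann_R(z) = 𝔭 and z·γ̃' does not lie in the image of R in Q. -/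
open CategoryTheory CategoryTheory.Abelian

universe u

namespace IsLocalRing

variable {S : Type*} [CommRing S] [IsLocalRing S]

/-- If the socle of a local ring `S` is generated by one element, then `Hom(M, S)` has length at
most one for every simple module `M`. -/
theorem length_linearMap_le_one_of_isSimpleModule {u : S}
    (hu : ∀ a ∈ maximalIdeal S, a * u = 0)
    (hsoc : ∀ x : S, (∀ a ∈ maximalIdeal S, a * x = 0) → ∃ r, x = r * u)
    (M : Type*) [AddCommGroup M] [Module S M] [IsSimpleModule S M] :
    Module.length S (M →ₗ[S] S) ≤ 1 := by
  obtain ⟨I, hI, ⟨e⟩⟩ := isSimpleModule_iff_quot_maximal.mp ‹IsSimpleModule S M›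
  obtain rfl := IsLocalRing.eq_maximalIdeal hI
  let x : M := e.symm (Submodule.Quotient.mk 1)
  have hx : ∀ a ∈ maximalIdeal S, a • x = 0 := fun a ha ↦ by
    rw [← map_smul, ← Submodule.Quotient.mk_smul, smul_eq_mul, mul_one,
      (Submodule.Quotient.mk_eq_zero _).mpr ha, map_zero]
  have hgen : ∀ y : M, ∃ s : S, y = s • x := fun y ↦ by
    obtain ⟨s, hs⟩ := Submodule.Quotient.mk_surjective _ (e y)
    refine ⟨s, e.injective ?_⟩
    rw [map_smul, LinearEquiv.apply_symm_apply, ← hs, ← Submodule.Quotient.mk_smul, smul_eq_mul,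
      mul_one]
  let ev : (M →ₗ[S] S) →ₗ[S] S := LinearMap.applyₗ x
  have hev : Function.Injective ev := fun f g hfg ↦ LinearMap.ext fun y ↦ by
    obtain ⟨s, rfl⟩ := hgen y
    rw [map_smul, map_smul]
    exact congrArg (s • ·) hfg
  let mu : (S ⧸ maximalIdeal S) →ₗ[S] S :=
    (maximalIdeal S).liftQ (LinearMap.toSpanSingleton S S u) fun a ha ↦ by
      simpa using hu a ha
  have hrange : ∀ f, ev f ∈ LinearMap.range mu := fun f ↦ by
    obtain ⟨r, hr⟩ := hsoc (ev f) fun a ha ↦ by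
      change a • f x = 0
      rw [← map_smul, hx a ha, map_zero]
    exact ⟨Submodule.Quotient.mk r, hr.symm⟩
  calc Module.length S (M →ₗ[S] S)
      ≤ Module.length S (LinearMap.range mu) :=
        Module.length_le_of_injective (ev.codRestrict _ hrange) fun f g h ↦
          hev (congrArg Subtype.val h)
    _ ≤ Module.length S (S ⧸ maximalIdeal S) :=
        Module.length_le_of_surjective mu.rangeRestrict mu.surjective_rangeRestrict
    _ = 1 := Module.length_eq_one_iff.mpr (isSimpleModule_iff_quot_maximal.mpr
        ⟨_, inferInstance, ⟨LinearEquiv.refl _ _⟩⟩)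

/-- If the socle of a local ring `S` is generated by one element, then dualizing into `S` does not
increase the length of a module of finite length. -/
theorem length_linearMap_le {u : S}
    (hu : ∀ a ∈ maximalIdeal S, a * u = 0)
    (hsoc : ∀ x : S, (∀ a ∈ maximalIdeal S, a * x = 0) → ∃ r, x = r * u)
    {M : Type*} [AddCommGroup M] [Module S M] (hM : IsFiniteLength S M) :
    Module.length S (M →ₗ[S] S) ≤ Module.length S M := by
  induction hM with
  | of_subsingleton => simp [Module.length_eq_zero]
  | @of_simple_quotient M _ _ N _ _ ih =>
    let res : (M →ₗ[S] S) →ₗ[S] (N →ₗ[S] S) := LinearMap.lcomp S S N.subtype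
    let inf : ((M ⧸ N) →ₗ[S] S) →ₗ[S] (M →ₗ[S] S) := LinearMap.lcomp S S N.mkQ
    have hex : Function.Exact inf res.rangeRestrict := fun f ↦ by
      constructor
      · intro hf
        refine ⟨N.liftQ f fun y hy ↦ ?_, by ext; simp [inf]⟩
        exact LinearMap.congr_fun (congrArg Subtype.val hf) (⟨y, hy⟩ : N)
      · rintro ⟨g, rfl⟩
        refine Subtype.ext (LinearMap.ext fun y ↦ ?_)
        change g (N.mkQ y) = 0
        rw [N.mkQ_apply, (Submodule.Quotient.mk_eq_zero N).mpr y.2, map_zero]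
    have hinj : Function.Injective inf := fun f g h ↦ by
      refine LinearMap.ext fun y ↦ ?_
      obtain ⟨y, rfl⟩ := N.mkQ_surjective y
      exact LinearMap.congr_fun h y
    rw [Module.length_eq_add_of_exact (P := LinearMap.range res) inf res.rangeRestrict hinj
        res.surjective_rangeRestrict hex,
      Module.length_eq_add_of_exact N.subtype N.mkQ N.subtype_injective N.mkQ_surjective
        (LinearMap.exact_subtype_mkQ N), add_comm]
    refine add_le_add ((Module.length_le_of_injective _
      (LinearMap.range res).subtype_injective).trans ih) ?_
    rw [Module.length_eq_one_iff.mpr ‹IsSimpleModule S (M ⧸ N)›]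
    exact length_linearMap_le_one_of_isSimpleModule hu hsoc _

/-- An Artinian local ring with principal socle is self-injective. -/
theorem exists_eq_mul_of_isArtinianRing [IsArtinianRing S] {u : S}
    (hu : ∀ a ∈ maximalIdeal S, a * u = 0)
    (hsoc : ∀ x : S, (∀ a ∈ maximalIdeal S, a * x = 0) → ∃ r, x = r * u)
    (I : Ideal S) (f : I →ₗ[S] S) : ∃ r : S, ∀ x : I, f x = r * x := by
  let res : S →ₗ[S] (I →ₗ[S] S) := LinearMap.toSpanSingleton S _ I.subtype
  have hres : ∀ r (x : I), res r x = r * x := fun r x ↦ rfl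
  let inf : ((S ⧸ I) →ₗ[S] S) →ₗ[S] S := LinearMap.applyₗ (Submodule.Quotient.mk 1)
  have hinj : Function.Injective inf := fun f g h ↦ by
    refine Submodule.linearMap_qext _ (LinearMap.ext_ring h)
  have hex : Function.Exact inf res.rangeRestrict := fun s ↦ by
    constructor
    · intro hs
      have hs' : res s = 0 := congrArg Subtype.val hs
      refine ⟨I.liftQ (LinearMap.toSpanSingleton S S s) fun y hy ↦ ?_, ?_⟩
      · simpa [hres, mul_comm] using LinearMap.congr_fun hs' (⟨y, hy⟩ : I)
      · exact one_mul s
    · rintro ⟨g, rfl⟩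
      refine Subtype.ext (LinearMap.ext fun y ↦ ?_)
      change g (Submodule.Quotient.mk 1) * (y : S) = 0
      rw [mul_comm, ← smul_eq_mul, ← map_smul, ← Submodule.Quotient.mk_smul, smul_eq_mul, mul_one,
        (Submodule.Quotient.mk_eq_zero I).mpr y.2, map_zero]
  have hfin : ∀ (M : Type _) [AddCommGroup M] [Module S M] [Module.Finite S M],
      IsFiniteLength S M := fun M _ _ _ ↦
    isFiniteLength_iff_isNoetherian_isArtinian.mpr ⟨inferInstance, inferInstance⟩
  have h₁ := Module.length_eq_add_of_exact (P := LinearMap.range res) inf res.rangeRestrict hinj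
    res.surjective_rangeRestrict hex
  have h₂ := Module.length_eq_add_of_exact I.subtype I.mkQ I.subtype_injective I.mkQ_surjective
        (LinearMap.exact_subtype_mkQ I)
  have h₃ := length_linearMap_le hu hsoc (hfin (S ⧸ I))
  have h₄ := length_linearMap_le hu hsoc (hfin I)
  have hne : Module.length S (S ⧸ I) ≠ ⊤ := Module.length_ne_top
  have hle : Module.length S (I →ₗ[S] S) ≤ Module.length S (LinearMap.range res) := by
    refine h₄.trans ((ENat.add_le_add_iff_right hne).mp ?_)
    rw [← h₂, h₁, add_comm]
    exact add_le_add le_rfl h₃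
  have htop : LinearMap.range res = ⊤ := by
    by_contra h
    exact (Submodule.length_lt h).not_ge hle
  obtain ⟨r, hr⟩ := (htop ▸ Submodule.mem_top : f ∈ LinearMap.range res)
  exact ⟨r, fun x ↦ by rw [← hr, hres]⟩

end IsLocalRing

namespace Ideal

variable {R : Type*} [CommRing R]

/-- If `R ⧸ (t)` is self-injective and `t` is a nonzerodivisor on `R ⧸ J`, then a linear map
`J → R` agrees with a multiplication up to a multiple of `t`. -/
theorem exists_eq_mul_add_mul_of_quotient_self_injective {t : R}
    (ht : t ∈ nonZeroDivisors R)
    (hself : ∀ (I : Ideal (R ⧸ span {t})) (f : I →ₗ[R ⧸ span {t}] R ⧸ span {t}),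
      ∃ r, ∀ x : I, f x = r * x)
    (J : Ideal R) (hJ : ∀ x, t * x ∈ J → x ∈ J) (φ : J →ₗ[R] R) :
    ∃ (r : R) (ψ : J →ₗ[R] R), ∀ x : J, φ x = r * x + t * ψ x := by
  let q := Ideal.Quotient.mk (span {t})
  have hq : Function.Surjective q := Ideal.Quotient.mk_surjective
  have hker : ∀ x : J, q x = 0 → q (φ x) = 0 := fun x hx ↦ by
    obtain ⟨y, hy⟩ := mem_span_singleton'.mp (Ideal.Quotient.eq_zero_iff_mem.mp hx)
    have hyJ : y ∈ J := hJ y (by rw [mul_comm, hy]; exact x.2)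
    have : x = t • (⟨y, hyJ⟩ : J) := Subtype.ext (by simp [← hy, mul_comm])
    rw [this, map_smul]
    exact Ideal.Quotient.eq_zero_iff_mem.mpr (mul_mem_right _ _ (mem_span_singleton_self t))
  have hker' : ∀ x y : J, q x = q y → q (φ x) = q (φ y) := fun x y h ↦ by
    rw [← sub_eq_zero, ← map_sub, ← map_sub]
    exact hker _ (by simpa [sub_eq_zero] using h)
  have hex : ∀ y : J.map q, ∃ x : J, q x = y := fun y ↦ by
    obtain ⟨x, hx, hxy⟩ := (mem_map_iff_of_surjective q hq).mp y.2
    exact ⟨⟨x, hx⟩, hxy⟩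
  choose g hg using hex
  obtain ⟨r, hr⟩ := hself (J.map q)
    { toFun := fun y ↦ q (φ (g y))
      map_add' := fun y z ↦ by
        rw [← map_add, ← map_add]
        exact hker' _ _ (by simp [hg])
      map_smul' := fun s y ↦ by
        obtain ⟨s, rfl⟩ := hq s
        rw [RingHom.id_apply, smul_eq_mul, ← map_mul, ← smul_eq_mul, ← map_smul]
        exact hker' _ _ (by simp [hg]) }
  obtain ⟨r, rfl⟩ := hq r
  have hmem : ∀ x : J, ∃ y, t * y = φ x - r * x := fun x ↦ by
    have h := hr ⟨q x, mem_map_of_mem q x.2⟩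
    have h' := hker' (g ⟨q x, mem_map_of_mem q x.2⟩) x (hg _)
    replace h : q (φ x) = q r * q x := h'.symm.trans h
    obtain ⟨y, hy⟩ := mem_span_singleton'.mp
      (Ideal.Quotient.eq.mp (h.trans (map_mul q r x).symm))
    exact ⟨y, by rw [mul_comm, hy]⟩
  choose ψ hψ using hmem
  refine ⟨r, { toFun := ψ, map_add' := fun x y ↦ ?_, map_smul' := fun s x ↦ ?_ }, fun x ↦ ?_⟩
  · refine (mul_cancel_left_mem_nonZeroDivisors ht).mp ?_
    rw [mul_add, hψ, hψ, hψ, map_add, Submodule.coe_add]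
    ring
  · refine (mul_cancel_left_mem_nonZeroDivisors ht).mp ?_
    rw [RingHom.id_apply, smul_eq_mul, mul_left_comm, hψ, hψ, map_smul, Submodule.coe_smul,
      smul_eq_mul, smul_eq_mul]
    ring
  · change φ x = r * x + t * ψ x
    rw [hψ]
    ring

/-- If `R ⧸ (t)` is self-injective for some nonzerodivisor `t` of a Noetherian local ring `R`, then
every linear map `J → R` from an ideal `J` with `t` a nonzerodivisor on `R ⧸ J` is a
multiplication. -/
theorem exists_eq_mul_of_quotient_self_injective [IsNoetherianRing R] [IsLocalRing R] {t : R}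
    (ht : t ∈ nonZeroDivisors R) (htm : t ∈ IsLocalRing.maximalIdeal R)
    (hself : ∀ (I : Ideal (R ⧸ span {t})) (f : I →ₗ[R ⧸ span {t}] R ⧸ span {t}),
      ∃ r, ∀ x : I, f x = r * x)
    (J : Ideal R) (hJ : ∀ x, t * x ∈ J → x ∈ J) (φ : J →ₗ[R] R) :
    ∃ r : R, ∀ x : J, φ x = r * x := by
  let res : R →ₗ[R] (J →ₗ[R] R) := LinearMap.toSpanSingleton R _ J.subtype
  have hle : (⊤ : Submodule R (J →ₗ[R] R)) ≤ LinearMap.range res := by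
    refine Submodule.le_of_le_smul_of_le_jacobson_bot (I := span {t})
      (IsNoetherian.noetherian _) ?_ fun f _ ↦ ?_
    · rw [IsLocalRing.jacobson_eq_maximalIdeal _ bot_ne_top]
      exact (span_singleton_le_iff_mem _).mpr htm
    · obtain ⟨r, ψ, h⟩ := exists_eq_mul_add_mul_of_quotient_self_injective ht hself J hJ f
      have : f = res r + t • ψ := LinearMap.ext fun x ↦ h x
      rw [this]
      exact Submodule.add_mem_sup ⟨r, rfl⟩
        (Submodule.smul_mem_smul (mem_span_singleton_self t) trivial)
  obtain ⟨r, hr⟩ := hle (Submodule.mem_top : φ ∈ _)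
  exact ⟨r, fun x ↦ by rw [← hr]; rfl⟩

end Ideal

/-- A local ring of nonzero depth has a nonzerodivisor in its maximal ideal. -/
theorem exists_mem_nonZeroDivisors_of_moduleDepth_ne_zero {R : Type*} [CommRing R] [IsLocalRing R]
    (h : moduleDepth R R ≠ 0) :
    ∃ t ∈ nonZeroDivisors R, t ∈ IsLocalRing.maximalIdeal R := by
  by_contra! hno
  refine h (le_antisymm (iSup_le fun rs ↦ iSup_le fun hrs ↦ iSup_le fun hm ↦ ?_) zero_le)
  cases rs with
  | nil => simp
  | cons t rs =>
    have ht := ((RingTheory.Sequence.isRegular_cons_iff R t rs).mp hrs).1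
    refine absurd (hm t (by simp)) (hno t (mem_nonZeroDivisors_iff_right.mpr fun x hx ↦ ?_))
    exact ht (by simpa [mul_comm] using hx)

namespace IsGorensteinOneDim

open IsLocalRing

variable {R : Type u} [CommRing R] [IsLocalRing R] [HasExt.{u} (ModuleCat.{u} R)]

/-- Over a one-dimensional Gorenstein local ring, `Hom(𝔪, R)` modulo multiplications is cyclic. -/
theorem exists_linearMap_maximalIdeal (hGor : IsGorensteinOneDim R) :
    ∃ f₀ : maximalIdeal R →ₗ[R] R, ∀ f : maximalIdeal R →ₗ[R] R,
      ∃ r s : R, ∀ x, f x = r * f₀ x + s * x := by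
  obtain ⟨-, e, -, he⟩ := hGor
  let g : R →ₗ[R] ResidueField R := Algebra.linearMap R (ResidueField R)
  have hg : Function.Surjective g := residue_surjective
  have hker : LinearMap.ker g = maximalIdeal R := by
    ext x
    exact residue_eq_zero_iff x
  have hS := LinearMap.shortExact_shortComplexKer hg
  have : Projective g.shortComplexKer.X₂ :=
    inferInstanceAs (Projective (ModuleCat.of R R))
  have hsurj : ∀ e : Ext (ModuleCat.of R (ResidueField R)) (ModuleCat.of R R) 1,
      ∃ f : LinearMap.ker g →ₗ[R] R,
        hS.extClass.comp (Ext.mk₀ (ModuleCat.ofHom f)) (add_zero 1) = e := fun e ↦ by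
    obtain ⟨x, hx⟩ := precomp_extClass_surjective_of_projective_X₂ (ModuleCat.of R R) hS 0 e
    obtain ⟨f, rfl⟩ := Ext.addEquiv₀.symm.surjective x
    exact ⟨f.hom, hx⟩
  rw [← hker]
  obtain ⟨f₀, rfl⟩ := hsurj e
  refine ⟨f₀, fun f ↦ ?_⟩
  obtain ⟨r, hr⟩ := he (hS.extClass.comp (Ext.mk₀ (ModuleCat.ofHom f)) (add_zero 1))
  have hzero : hS.extClass.comp (Ext.mk₀ (ModuleCat.ofHom (f - r • f₀))) (add_zero 1) = 0 := by
    have : ModuleCat.ofHom (f - r • f₀) =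
        ModuleCat.ofHom f - ModuleCat.ofHom f₀ ≫ (r • 𝟙 (ModuleCat.of R R)) := by
      ext; simp
    rw [this, sub_eq_add_neg, Ext.mk₀_add, Ext.mk₀_neg, Ext.comp_add, Ext.comp_neg, hr,
      ← Ext.mk₀_comp_mk₀, Ext.comp_assoc_of_third_deg_zero, add_neg_cancel]
  obtain ⟨y, hy⟩ := Ext.contravariant_sequence_exact₁ hS _ _ _ hzero
  obtain ⟨h, rfl⟩ := Ext.addEquiv₀.symm.surjective y
  refine ⟨r, h.hom 1, fun x ↦ ?_⟩
  have hy' : ModuleCat.ofHom (LinearMap.ker g).subtype ≫ h = ModuleCat.ofHom (f - r • f₀) := by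
    apply Ext.addEquiv₀.symm.injective
    exact (Ext.mk₀_comp_mk₀ _ _).symm.trans hy
  have hx : h.hom (x : R) = f x - r * f₀ x := ConcreteCategory.congr_hom hy' x
  have hx' : h.hom (x : R) = x * h.hom 1 := by
    rw [← smul_eq_mul, ← map_smul, smul_eq_mul, mul_one]
  rw [mul_comm (h.hom 1), ← hx', hx]
  ring

/-- Modulo a nonzerodivisor, the socle of a one-dimensional Gorenstein local ring is principal. -/
theorem exists_socle_generator (hGor : IsGorensteinOneDim R) {t : R}
    (ht : t ∈ nonZeroDivisors R) (htm : t ∈ maximalIdeal R) :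
    ∃ u : R, (∀ a ∈ maximalIdeal R, t ∣ a * u) ∧
      ∀ x : R, (∀ a ∈ maximalIdeal R, t ∣ a * x) → ∃ r, t ∣ x - r * u := by
  obtain ⟨f₀, hf₀⟩ := hGor.exists_linearMap_maximalIdeal
  refine ⟨f₀ ⟨t, htm⟩, fun a ha ↦ ⟨f₀ ⟨a, ha⟩, ?_⟩, fun x hx ↦ ?_⟩
  · rw [← smul_eq_mul, ← smul_eq_mul, ← map_smul, ← map_smul]
    exact congrArg f₀ (Subtype.ext (mul_comm a t))
  · choose g hg using hx
    obtain ⟨r, s, h⟩ := hf₀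
      { toFun := fun a ↦ g a a.2
        map_add' := fun a b ↦ (mul_cancel_left_mem_nonZeroDivisors ht).mp (by
          rw [mul_add, ← hg, ← hg, ← hg, Submodule.coe_add, add_mul])
        map_smul' := fun c a ↦ (mul_cancel_left_mem_nonZeroDivisors ht).mp (by
          rw [RingHom.id_apply, smul_eq_mul, mul_left_comm, ← hg, ← hg, Submodule.coe_smul,
            smul_eq_mul, mul_assoc]) }
    have hx : g t htm = x := (mul_cancel_left_mem_nonZeroDivisors ht).mp (hg t htm).symm
    have h' : g t htm = r * f₀ ⟨t, htm⟩ + s * t := h ⟨t, htm⟩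
    exact ⟨r, s, by rw [← hx, h']; ring⟩

/-- A one-dimensional Gorenstein local ring has a nonzerodivisor in its maximal ideal. -/
theorem exists_mem_nonZeroDivisors (hGor : IsGorensteinOneDim R) (hdim : ringKrullDim R = 1) :
    ∃ t ∈ nonZeroDivisors R, t ∈ maximalIdeal R :=
  exists_mem_nonZeroDivisors_of_moduleDepth_ne_zero fun h ↦ by
    have := hGor.1
    rw [h, hdim] at this
    exact zero_ne_one (WithBot.coe_injective this)

/-- Over a one-dimensional Gorenstein local ring `R`, every linear map to `R` from an ideal
`Ann(p)` is a multiplication. -/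
theorem exists_eq_mul_of_annihilator [IsNoetherianRing R] (hGor : IsGorensteinOneDim R)
    (hdim : ringKrullDim R = 1) (p : Ideal R) (φ : p.annihilator →ₗ[R] R) :
    ∃ r : R, ∀ x : p.annihilator, φ x = r * x := by
  obtain ⟨t, ht, htm⟩ := hGor.exists_mem_nonZeroDivisors hdim
  obtain ⟨u, hu, hsoc⟩ := hGor.exists_socle_generator ht htm
  have hne : Ideal.span {t} ≠ ⊤ := fun h ↦
    (mem_maximalIdeal t).mp htm (Ideal.span_singleton_eq_top.mp h)
  have : Nontrivial (R ⧸ Ideal.span {t}) := Ideal.Quotient.nontrivial_iff.mpr hne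
  have hq : Function.Surjective (Ideal.Quotient.mk (Ideal.span {t})) := Ideal.Quotient.mk_surjective
  have : IsLocalRing (R ⧸ Ideal.span {t}) := .of_surjective' _ hq
  have : IsArtinianRing (R ⧸ Ideal.span {t}) := by
    rw [isArtinianRing_iff_krullDimLE_zero, Ring.krullDimLE_iff]
    have h := ringKrullDim_quotient_succ_le_of_nonZeroDivisor ht
    rw [hdim] at h
    exact ENat.WithBot.add_le_add_one_right_iff.mp (h.trans_eq (zero_add 1).symm)
  have hloc := IsLocalHom.of_surjective _ hq
  have hmem : ∀ a ∈ maximalIdeal R,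
      Ideal.Quotient.mk (Ideal.span {t}) a ∈ maximalIdeal (R ⧸ Ideal.span {t}) :=
    fun a ha h ↦ ha (hloc.map_nonunit a h)
  have hzero : ∀ x, Ideal.Quotient.mk (Ideal.span {t}) x = 0 ↔ t ∣ x := fun x ↦ by
    rw [Ideal.Quotient.eq_zero_iff_mem, Ideal.mem_span_singleton]
  refine Ideal.exists_eq_mul_of_quotient_self_injective ht htm
    (exists_eq_mul_of_isArtinianRing (u := Ideal.Quotient.mk _ u) (fun a ha ↦ ?_) fun x hx ↦ ?_)
    _ (fun x hx ↦ ?_) φ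
  · obtain ⟨a, rfl⟩ := hq a
    rw [← map_mul, hzero]
    exact hu a fun h ↦ ha (h.map _)
  · obtain ⟨x, rfl⟩ := hq x
    obtain ⟨r, hr⟩ := hsoc x fun a ha ↦ by
      rw [← hzero, map_mul]
      exact hx _ (hmem a ha)
    exact ⟨Ideal.Quotient.mk _ r, by rwa [← map_mul, ← sub_eq_zero, ← map_sub, hzero]⟩
  · rw [Submodule.mem_annihilator] at hx ⊢
    intro y hy
    refine (mul_cancel_left_mem_nonZeroDivisors ht).mp ?_
    rw [mul_zero, smul_eq_mul, ← mul_assoc]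
    exact hx y hy

/-- Over a one-dimensional Gorenstein local ring, every nonzero element of the annihilator of a
minimal prime `p` has annihilator `p`. -/
theorem mul_eq_zero_iff_of_mem_annihilator [IsNoetherianRing R] (hGor : IsGorensteinOneDim R)
    (hdim : ringKrullDim R = 1) {p : Ideal R} (hp : p ∈ minimalPrimes R) {z : R}
    (hz : z ∈ p.annihilator) (hz0 : z ≠ 0) (r : R) : r * z = 0 ↔ r ∈ p := by
  have hpz : ∀ a ∈ p, a * z = 0 := fun a ha ↦ by
    rw [mul_comm]
    exact Submodule.mem_annihilator.mp hz a ha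
  refine ⟨fun hr ↦ ?_, hpz r⟩
  obtain ⟨t, ht, htm⟩ := hGor.exists_mem_nonZeroDivisors hdim
  obtain ⟨q, hq, hle⟩ := exists_le_isAssociatedPrime_of_isNoetherianRing R z hz0
  obtain ⟨hqp, w, hw⟩ := isAssociatedPrime_iff.mp hq
  have hzq : ∀ a, a * z = 0 → a ∈ q := fun a ha ↦
    hle (by rwa [Submodule.mem_colon_singleton, Submodule.mem_bot])
  have hdim1 : Ring.KrullDimLE 1 R := Ring.krullDimLE_iff.mpr hdim.le
  rcases Ring.krullDimLE_one_iff.mp hdim1 q hqp with hmin | hmax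
  · exact hmin.2 hp.1 (fun a ha ↦ hzq a (hpz a ha)) (hzq r hr)
  · rw [← IsLocalRing.eq_maximalIdeal hmax, hw, Submodule.mem_colon_singleton, Submodule.mem_bot,
      smul_eq_mul, mul_comm] at htm
    have hw0 : w = 0 := (mul_right_mem_nonZeroDivisors_eq_zero_iff ht).mp htm
    exact absurd ((Ideal.eq_top_iff_one q).mpr (by simp [hw, hw0])) hqp.ne_top

end IsGorensteinOneDim


/-- Let `R` be a one-dimensional Gorenstein complete Noetherian local ring, `𝔭` a minimal
prime, `R' = R/𝔭`, `Q = Q(R)`, `Q' = Q(R')`, and `π : Q → Q'` the canonical surjection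
coming from `Q/𝔭Q ≅ Q'`.  Let `γ̃' ∈ Q` be such that `γ' = π(γ̃')` satisfies
`γ'·m_{R̄'} ⊆ R'` (where `R̄'` is the integral closure of `R'` in `Q'`, a local ring whose
maximal ideal consists of its nonunits) and `γ' ∉ R'`.  Then there exists `z ∈ R` with
`Ann_R(z) = 𝔭` and `z·γ̃' ∉ R`. -/
theorem exists_z_ann_eq_minimalPrime
    (R : Type u) [CommRing R] [IsNoetherianRing R] [IsLocalRing R]
    [IsAdicComplete (IsLocalRing.maximalIdeal R) R]
    [HasExt.{u} (ModuleCat.{u} R)]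
    (hdim : ringKrullDim R = 1) (hGor : IsGorensteinOneDim R)
    (p : Ideal R) (hp : p ∈ minimalPrimes R)
    (Q : Type*) [CommRing Q] [Algebra R Q] [IsLocalization (nonZeroDivisors R) Q]
    (Q' : Type*) [Field Q'] [Algebra (R ⧸ p) Q'] [IsFractionRing (R ⧸ p) Q']
    [Algebra R Q'] [IsScalarTower R (R ⧸ p) Q']
    (π : Q →ₐ[R] Q') (hπ : Function.Surjective π)
    (γt : Q)
    (h1 : ∀ x : integralClosure (R ⧸ p) Q', ¬IsUnit x →
      π γt * (x : Q') ∈ (algebraMap (R ⧸ p) Q').range)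
    (h2 : π γt ∉ (algebraMap (R ⧸ p) Q').range) :
    ∃ z : R, (∀ r : R, r * z = 0 ↔ r ∈ p) ∧
      algebraMap R Q z * γt ∉ (algebraMap R Q).range := by
  obtain ⟨hprime, z₀, hz₀⟩ := isAssociatedPrime_iff.mp
    (Module.associatedPrimes.minimalPrimes_annihilator_subset_associatedPrimes R R
      (by rwa [Module.annihilator_eq_bot.mpr inferInstance]))
  have hz₀p : ∀ r, r * z₀ = 0 ↔ r ∈ p := fun r ↦ by
    rw [hz₀, Submodule.mem_colon_singleton, Submodule.mem_bot, smul_eq_mul]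
  have hinj : Function.Injective (algebraMap R Q) := IsLocalization.injective Q le_rfl
  by_contra! hcon
  have hex : ∀ z : p.annihilator, ∃ y, algebraMap R Q y = algebraMap R Q z * γt := fun z ↦ by
    by_cases hz : (z : R) = 0
    · exact ⟨0, by simp [hz]⟩
    · exact hcon z (hGor.mul_eq_zero_iff_of_mem_annihilator hdim hp z.2 hz)
  choose φ hφ using hex
  obtain ⟨r, hr⟩ := hGor.exists_eq_mul_of_annihilator hdim p
    { toFun := φ
      map_add' := fun x y ↦ hinj (by simp [hφ, add_mul])
      map_smul' := fun c x ↦ hinj (by simp [hφ, mul_assoc]) }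
  have hz₀J : z₀ ∈ p.annihilator := Submodule.mem_annihilator.mpr fun y hy ↦ by
    rw [smul_eq_mul, mul_comm, (hz₀p y).mpr hy]
  have hr₀ : algebraMap R Q z₀ * γt = algebraMap R Q (r * z₀) := by
    rw [← hφ ⟨z₀, hz₀J⟩]
    exact congrArg _ (hr ⟨z₀, hz₀J⟩)
  obtain ⟨⟨a, s⟩, hs⟩ := IsLocalization.surj (nonZeroDivisors R) γt
  have hsp : (s : R) ∉ p := fun h ↦ by
    have hz₀0 : z₀ = 0 := (mul_right_mem_nonZeroDivisors_eq_zero_iff s.2).mp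
      (by rw [mul_comm, (hz₀p s).mpr h])
    exact hprime.ne_top ((Ideal.eq_top_iff_one p).mpr ((hz₀p 1).mp (by simp [hz₀0])))
  have ha : a - r * s ∈ p := (hz₀p _).mp <| hinj <| by
    simp only [map_mul, map_sub, map_zero] at hr₀ hs ⊢
    linear_combination -algebraMap R Q z₀ * hs + algebraMap R Q s * hr₀
  have hker : ∀ x : R, algebraMap R Q' x = 0 ↔ x ∈ p := fun x ↦ by
    rw [IsScalarTower.algebraMap_apply R (R ⧸ p) Q',
      map_eq_zero_iff _ (IsFractionRing.injective (R ⧸ p) Q')]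
    exact Ideal.Quotient.eq_zero_iff_mem
  have hπs : π γt * algebraMap R Q' s = algebraMap R Q' r * algebraMap R Q' s := by
    have h := congrArg π hs
    rw [map_mul, AlgHom.commutes, AlgHom.commutes] at h
    rw [h, ← map_mul, ← sub_eq_zero, ← map_sub, hker]
    exact ha
  refine h2 ⟨algebraMap R (R ⧸ p) r, ?_⟩
  rw [← IsScalarTower.algebraMap_apply]
  exact (mul_right_cancel₀ (mt (hker s).mp hsp) hπs).symm
end

section
/- Let R be a one-dimensional Gorenstein complete Noetherian local ring which is not regular, with maximal ideal m and total quotient ring Q = Q(R). Let 𝔭 be a minimal prime of R, R' = R/𝔭, Q' = Q(R'), π : Q → Q' the canonical surjection via Q/𝔭Q ≅ Q', and R̄' the integral closure of R' in Q'. Suppose γ̃' ∈ Q satisfies π(γ̃')·m_{R̄'} ⊆ R' and π(γ̃') ∉ R', and z ∈ R satisfies Ann_R(z) = 𝔭 and z·γ̃' ∉ R. Then the element γ = z·γ̃' ∈ Q satisfies γ·m ⊆ m, where m is viewed inside Q; in particular multiplication by γ defines an R-module endomorphism of m. -/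
open CategoryTheory CategoryTheory.Abelian

universe u

/-- A Noetherian local ring is regular if its maximal ideal can be generated by
`dim R` many elements. -/
def IsRegularLocal (R : Type*) [CommRing R] [IsLocalRing R] : Prop :=
  ∃ s : Finset R, Ideal.span (s : Set R) = IsLocalRing.maximalIdeal R ∧
    (s.card : WithBot ℕ∞) = ringKrullDim R

/-- If `γ` carries the maximal ideal of a one-dimensional non-regular local ring into the ring,
then it carries it into the maximal ideal. -/
theorem mem_maximalIdeal_of_mul_mem_range {R Q : Type*} [CommRing R] [IsLocalRing R]
    [CommRing Q] [Algebra R Q] (hinj : Function.Injective (algebraMap R Q))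
    (hdim : ringKrullDim R = 1) (hnotreg : ¬ IsRegularLocal R) {γ : Q}
    (hγ : ∀ y ∈ IsLocalRing.maximalIdeal R, γ * algebraMap R Q y ∈ (algebraMap R Q).range)
    {y w : R} (hy : y ∈ IsLocalRing.maximalIdeal R)
    (hw : γ * algebraMap R Q y = algebraMap R Q w) : w ∈ IsLocalRing.maximalIdeal R := by
  by_contra hwu
  rw [IsLocalRing.mem_maximalIdeal, mem_nonunits_iff, not_not] at hwu
  refine hnotreg ⟨{y}, le_antisymm ?_ fun a ha => ?_, by simp [hdim]⟩
  · simpa [Ideal.span_singleton_le_iff_mem] using hy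
  · obtain ⟨b, hb⟩ := hγ a ha
    have hab : a * w = b * y := hinj (by rw [map_mul, map_mul, hb, ← hw]; ring)
    rw [Finset.coe_singleton, Ideal.mem_span_singleton, ← hwu.dvd_mul_right, hab]
    exact dvd_mul_left y b

/-- An element of `Q` in the kernel of `π : Q → Frac (R / p)` is killed by any element of `R`
that annihilates `p`. -/
theorem algebraMap_mul_eq_zero_of_map_eq_zero {R Q Q' : Type*} [CommRing R] [CommRing Q]
    [Algebra R Q] [IsLocalization (nonZeroDivisors R) Q] (p : Ideal R) [CommRing Q']
    [Algebra (R ⧸ p) Q'] [IsFractionRing (R ⧸ p) Q'] [Algebra R Q']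
    [IsScalarTower R (R ⧸ p) Q'] (π : Q →ₐ[R] Q') {z : R} (hz : ∀ r ∈ p, r * z = 0)
    {q : Q} (hq : π q = 0) : algebraMap R Q z * q = 0 := by
  obtain ⟨⟨a, s⟩, has⟩ := IsLocalization.surj (nonZeroDivisors R) q
  have hap : a ∈ p := by
    have h := congrArg π has
    rw [map_mul, hq, zero_mul, AlgHom.commutes,
      IsScalarTower.algebraMap_apply R (R ⧸ p) Q'] at h
    exact Ideal.Quotient.eq_zero_iff_mem.mp
      ((IsFractionRing.injective (R ⧸ p) Q') (by rw [map_zero]; exact h.symm))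
  refine (IsLocalization.map_units Q s).mul_left_injective ?_
  simp only [zero_mul]
  rw [mul_assoc, has, ← map_mul, mul_comm, hz a hap, map_zero]

/-- Let `R` be a one-dimensional Gorenstein complete Noetherian local ring which is not
regular, with maximal ideal `m` and total quotient ring `Q`.  Let `𝔭` be a minimal prime,
`R' = R/𝔭`, `Q' = Q(R')`, `π : Q → Q'` the canonical surjection via `Q/𝔭Q ≅ Q'`, and `R̄'`
the integral closure of `R'` in `Q'`.  Suppose `γ̃' ∈ Q` satisfies `π(γ̃')·m_{R̄'} ⊆ R'` and
`π(γ̃') ∉ R'`, and `z ∈ R` satisfies `Ann_R(z) = 𝔭` and `z·γ̃' ∉ R`.  Then `γ = z·γ̃'`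
satisfies `γ·m ⊆ m` inside `Q`; in particular multiplication by `γ` induces an `R`-module
endomorphism of `m`. -/
theorem gamma_multiplies_maximalIdeal_into_itself
    (R : Type u) [CommRing R] [IsNoetherianRing R] [IsLocalRing R]
    [IsAdicComplete (IsLocalRing.maximalIdeal R) R]
    [HasExt.{u} (ModuleCat.{u} R)]
    (hdim : ringKrullDim R = 1) (hGor : IsGorensteinOneDim R)
    (hnotreg : ¬ IsRegularLocal R)
    (p : Ideal R) (hp : p ∈ minimalPrimes R)
    (Q : Type*) [CommRing Q] [Algebra R Q] [IsLocalization (nonZeroDivisors R) Q]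
    (Q' : Type*) [Field Q'] [Algebra (R ⧸ p) Q'] [IsFractionRing (R ⧸ p) Q']
    [Algebra R Q'] [IsScalarTower R (R ⧸ p) Q']
    (π : Q →ₐ[R] Q') (hπ : Function.Surjective π)
    (γt : Q)
    (h1 : ∀ x : integralClosure (R ⧸ p) Q', ¬IsUnit x →
      π γt * (x : Q') ∈ (algebraMap (R ⧸ p) Q').range)
    (h2 : π γt ∉ (algebraMap (R ⧸ p) Q').range)
    (z : R) (hz : ∀ r : R, r * z = 0 ↔ r ∈ p)
    (hzγ : algebraMap R Q z * γt ∉ (algebraMap R Q).range) :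
    ∀ y ∈ IsLocalRing.maximalIdeal R, ∃ w ∈ IsLocalRing.maximalIdeal R,
      (algebraMap R Q z * γt) * algebraMap R Q y = algebraMap R Q w := by
  have : p.IsPrime := hp.1.1
  have hmem : ∀ y ∈ IsLocalRing.maximalIdeal R,
      (algebraMap R Q z * γt) * algebraMap R Q y ∈ (algebraMap R Q).range := by
    intro y hy
    have : IsLocalHom (Ideal.Quotient.mk p) := .of_surjective _ Ideal.Quotient.mk_surjective
    have hnu : ¬IsUnit (algebraMap (R ⧸ p) (integralClosure (R ⧸ p) Q')
        (Ideal.Quotient.mk p y)) := fun h =>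
      hy (isUnit_of_map_unit (Ideal.Quotient.mk p) y (isUnit_of_map_unit _ _ h))
    obtain ⟨r', hr'⟩ := h1 _ hnu
    obtain ⟨r, rfl⟩ := Ideal.Quotient.mk_surjective r'
    refine ⟨z * r, ?_⟩
    have hker : π (γt * algebraMap R Q y - algebraMap R Q r) = 0 := by
      rw [map_sub, map_mul, AlgHom.commutes, AlgHom.commutes,
        IsScalarTower.algebraMap_apply R (R ⧸ p) Q', IsScalarTower.algebraMap_apply R (R ⧸ p) Q']
      exact sub_eq_zero.mpr hr'.symm
    have h := algebraMap_mul_eq_zero_of_map_eq_zero p π (fun r hr => (hz r).mpr hr) hker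
    rw [map_mul]
    linear_combination -h
  intro y hy
  obtain ⟨w, hw⟩ := hmem y hy
  exact ⟨w, mem_maximalIdeal_of_mul_mem_range (IsLocalization.injective Q le_rfl) hdim hnotreg
    hmem hy hw.symm, hw.symm⟩
end

section
/- Let R be a one-dimensional Cohen-Macaulay Noetherian local ring, 𝔭 a minimal prime, R' = R/𝔭, Q = Q(R), Q' = Q(R') (a field), and let π : Q → Q' be the canonical surjection obtained from the R-algebra isomorphism Q/𝔭Q ≅ Q'. Let M be a finitely generated R-module such that M ⊗_R Q is a projective Q-module, and let h ∈ End_R(M). Then trace((h ⊗_R R') ⊗_{R'} Q') = π(trace(h ⊗_R Q)). -/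
open TensorProduct

namespace IsTraceOf

/-- The trace of an endomorphism does not depend on the chosen finite dual family. -/
theorem unique {A : Type*} [CommRing A] {P : Type*} [AddCommGroup P] [Module A P]
    {h : P →ₗ[A] P} {s t : A} (hs : IsTraceOf h s) (ht : IsTraceOf h t) : s = t := by
  obtain ⟨m, e, φ, he, rfl⟩ := hs
  obtain ⟨n, f, ψ, hf, rfl⟩ := ht
  have hφ (i : Fin m) : φ i (h (e i)) = ∑ j, ψ j (h (e i)) * φ i (f j) := by
    conv_lhs => rw [hf (h (e i))]
    simp [map_sum]
  have hψ (j : Fin n) : ψ j (h (f j)) = ∑ i, ψ j (h (e i)) * φ i (f j) := by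
    conv_lhs => rw [he (f j)]
    simp [map_sum, mul_comm]
  simp_rw [hφ, hψ]
  exact Finset.sum_comm

/-- Every endomorphism of a finitely generated projective module has a trace. -/
theorem exists_of_projective {A : Type*} [CommRing A] {P : Type*} [AddCommGroup P] [Module A P]
    [Module.Finite A P] [Module.Projective A P] (h : P →ₗ[A] P) : ∃ t, IsTraceOf h t := by
  obtain ⟨n, f, g, -, -, hfg⟩ := Module.Finite.exists_comp_eq_id_of_projective A P
  refine ⟨_, n, fun i => f (Pi.single i 1), fun i => LinearMap.proj i ∘ₗ g, fun y => ?_, rfl⟩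
  calc
    y = f (g y) := (LinearMap.congr_fun hfg y).symm
    _ = f (∑ i, g y i • Pi.single i 1) := by rw [← pi_eq_sum_univ' (g y)]
    _ = _ := by simp [map_sum]

/-- Traces are compatible with base change. -/
theorem of_isBaseChange {A B : Type*} [CommRing A] [CommRing B] [Algebra A B]
    {P N : Type*} [AddCommGroup P] [Module A P] [AddCommGroup N] [Module A N] [Module B N]
    [IsScalarTower A B N] {f : P →ₗ[A] N} (hf : IsBaseChange B f)
    {h : P →ₗ[A] P} {k : N →ₗ[B] N} (hk : ∀ x, k (f x) = f (h x)) {t : A}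
    (ht : IsTraceOf h t) : IsTraceOf k (algebraMap A B t) := by
  obtain ⟨n, e, φ, he, rfl⟩ := ht
  refine ⟨n, fun i => f (e i), fun i => hf.lift (Algebra.linearMap A B ∘ₗ φ i), fun y => ?_, ?_⟩
  · induction y using hf.inductionOn with
    | zero => simp
    | tmul x =>
      conv_lhs => rw [he x]
      simp [hf.lift_eq, map_sum]
    | smul b y hy =>
      conv_lhs => rw [hy]
      simp [Finset.smul_sum, mul_smul]
    | add y z hy hz =>
      conv_lhs => rw [hy, hz]
      simp [add_smul, Finset.sum_add_distrib]
  · simp [hk, hf.lift_eq, map_sum]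

end IsTraceOf

/-- Let `R` be a one-dimensional Cohen-Macaulay Noetherian local ring, `𝔭` a minimal prime,
`R' = R/𝔭`, `Q = Q(R)`, `Q' = Q(R')` (a field), and `π : Q → Q'` the canonical surjection
obtained from `Q/𝔭Q ≅ Q'`.  Let `M` be a finitely generated `R`-module with `M ⊗[R] Q`
projective over `Q`, and `h ∈ End_R(M)`.  Then `trace((h ⊗_R R') ⊗_{R'} Q') = π(trace(h ⊗_R Q))`
(both traces exist). -/
theorem trace_baseChange_compat
    (R : Type*) [CommRing R] [IsNoetherianRing R] [IsLocalRing R]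
    (hdim : ringKrullDim R = 1)
    (hCM : (moduleDepth R R : WithBot ℕ∞) = ringKrullDim R)
    (p : Ideal R) (hp : p ∈ minimalPrimes R)
    (Q : Type*) [CommRing Q] [Algebra R Q] [IsLocalization (nonZeroDivisors R) Q]
    (Q' : Type*) [Field Q'] [Algebra (R ⧸ p) Q'] [IsFractionRing (R ⧸ p) Q']
    [Algebra R Q'] [IsScalarTower R (R ⧸ p) Q']
    (π : Q →ₐ[R] Q') (hπ : Function.Surjective π)
    (M : Type*) [AddCommGroup M] [Module R M] [Module.Finite R M]
    (hproj : Module.Projective Q (Q ⊗[R] M))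
    (h : M →ₗ[R] M) :
    (∃ t : Q, IsTraceOf (h.baseChange Q) t) ∧
    (∃ t' : Q', IsTraceOf ((h.baseChange (R ⧸ p)).baseChange Q') t') ∧
    ∀ (t : Q) (t' : Q'), IsTraceOf (h.baseChange Q) t →
      IsTraceOf ((h.baseChange (R ⧸ p)).baseChange Q') t' → t' = π t := by
  obtain ⟨t, ht⟩ := IsTraceOf.exists_of_projective (h.baseChange Q)
  let : Algebra Q Q' := π.toRingHom.toAlgebra
  have : IsScalarTower R Q Q' := .of_algebraMap_eq fun r => (π.commutes r).symm
  have hM := TensorProduct.isBaseChange R M Q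
  let g : M →ₗ[R] Q' ⊗[R ⧸ p] ((R ⧸ p) ⊗[R] M) :=
    (TensorProduct.mk (R ⧸ p) Q' ((R ⧸ p) ⊗[R] M) 1).restrictScalars R ∘ₗ
      TensorProduct.mk R (R ⧸ p) M 1
  have hg : IsBaseChange Q' g :=
    (TensorProduct.isBaseChange R M (R ⧸ p)).comp
      (TensorProduct.isBaseChange (R ⧸ p) ((R ⧸ p) ⊗[R] M) Q')
  let f : Q ⊗[R] M →ₗ[Q] Q' ⊗[R ⧸ p] ((R ⧸ p) ⊗[R] M) := hM.lift g
  have hf : IsBaseChange Q' f := hM.of_comp (by rwa [hM.lift_comp])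
  have f_one_tmul (m : M) : f (1 ⊗ₜ m) = 1 ⊗ₜ (1 ⊗ₜ m) := hM.lift_eq g m
  have hcomm (x : Q ⊗[R] M) :
      (h.baseChange (R ⧸ p)).baseChange Q' (f x) = f (h.baseChange Q x) := by
    induction x using hM.inductionOn with
    | zero => simp
    | tmul m => simp [f_one_tmul]
    | smul q x hx => simp [LinearMap.map_smul_of_tower, hx]
    | add x y hx hy => simp [hx, hy]
  have key {s : Q} (hs : IsTraceOf (h.baseChange Q) s) :
      IsTraceOf ((h.baseChange (R ⧸ p)).baseChange Q') (π s) := hs.of_isBaseChange hf hcomm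
  exact ⟨⟨t, ht⟩, ⟨π t, key ht⟩, fun s s' hs hs' => hs'.unique (key hs)⟩
end

section
/- Let R be a one-dimensional Gorenstein complete Noetherian local ring which is not regular, with total quotient ring Q = Q(R). Let 𝔭 be a minimal prime of R, R' = R/𝔭, Q' = Q(R'), π : Q → Q' the canonical surjection via Q/𝔭Q ≅ Q', and R̄' the integral closure of R' in Q'. Suppose γ̃' ∈ Q satisfies π(γ̃')·m_{R̄'} ⊆ R' and π(γ̃') ∉ R', and z ∈ R satisfies Ann_R(z) = 𝔭; set γ = z·γ̃' and assume γ ∉ R. Let M be an indecomposable finitely generated maximal Cohen-Macaulay R-module which is not free and such that M_𝔮 is a free R_𝔮-module for every nonmaximal prime 𝔮, and let n = dim_{Q'}(M ⊗_R Q'). If n·1_R is a unit in R, then any g ∈ End_R(M) with g ⊗_R Q equal to multiplication by γ on M ⊗_R Q does not factor through a projective R-module. -/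
open CategoryTheory CategoryTheory.Abelian

universe u

/-- A module is indecomposable if it is nonzero and is not the (internal) direct sum of two
nonzero submodules. -/
def IsIndecomposableModule (R : Type*) [CommRing R] (M : Type*) [AddCommGroup M]
    [Module R M] : Prop :=
  Nontrivial M ∧ ¬∃ (N₁ N₂ : Submodule R M), IsCompl N₁ N₂ ∧ N₁ ≠ ⊥ ∧ N₂ ≠ ⊥

open TensorProduct

/-- An endomorphism of a finitely generated module that factors through a projective module is
a finite sum of endomorphisms of the form `m ↦ a m • b`. -/
lemma exists_eq_sum_smulRight_of_factors {R M P : Type*} [CommRing R] [AddCommGroup M]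
    [Module R M] [Module.Finite R M] [AddCommGroup P] [Module R P] [Module.Projective R P]
    (a : M →ₗ[R] P) (b : P →ₗ[R] M) :
    ∃ (F : Finset P) (α : P → M →ₗ[R] R) (β : P → M),
      b ∘ₗ a = ∑ i ∈ F, (α i).smulRight (β i) := by
  classical
  obtain ⟨s, hs⟩ := Module.projective_def'.1 ‹Module.Projective R P›
  obtain ⟨G, hG⟩ := Module.Finite.fg_top (R := R) (M := M)
  let F : Finset P := G.biUnion fun m => (s (a m)).support
  have hsupp : ∀ m, s (a m) ∈ Finsupp.supported R R (F : Set P) := by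
    have hle : Submodule.span R (G : Set M) ≤
        (Finsupp.supported R R (F : Set P)).comap (s ∘ₗ a) := by
      rw [Submodule.span_le]
      intro m hm
      rw [SetLike.mem_coe, Submodule.mem_comap, Finsupp.mem_supported]
      exact Finset.coe_subset.2
        (Finset.subset_biUnion_of_mem (fun m => (s (a m)).support) hm)
    intro m
    exact hle (hG ▸ Submodule.mem_top)
  refine ⟨F, fun i => Finsupp.lapply i ∘ₗ s ∘ₗ a, fun i => b i, ?_⟩
  ext m
  have hm : Finsupp.linearCombination R id (s (a m)) = a m := LinearMap.congr_fun hs (a m)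
  have hsum : a m = ∑ i ∈ F, s (a m) i • i := by
    conv_lhs => rw [← hm]
    rw [Finsupp.linearCombination_apply]
    exact Finsupp.sum_of_support_subset _ (Finset.coe_subset.1 (hsupp m)) _ (by simp)
  simp only [LinearMap.comp_apply, LinearMap.sum_apply, LinearMap.smulRight_apply,
    Finsupp.lapply_apply]
  conv_lhs => rw [hsum]
  simp [map_sum]

/-- The trace of an endomorphism factoring through a projective module lies in the base ring,
uniformly over all base changes that make the module free. -/
lemma exists_trace_baseChange_eq_algebraMap {R M P : Type*} [CommRing R] [AddCommGroup M]
    [Module R M] [Module.Finite R M] [AddCommGroup P] [Module R P] [Module.Projective R P]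
    (a : M →ₗ[R] P) (b : P →ₗ[R] M) :
    ∃ r : R, ∀ (S : Type*) [CommRing S] [Algebra R S] [Module.Free S (S ⊗[R] M)],
      LinearMap.trace S (S ⊗[R] M) ((b ∘ₗ a).baseChange S) = algebraMap R S r := by
  obtain ⟨F, α, β, h⟩ := exists_eq_sum_smulRight_of_factors a b
  refine ⟨∑ i ∈ F, α i (β i), fun S _ _ _ => ?_⟩
  have hrank : ∀ i, ((α i).smulRight (β i)).baseChange S =
      ((AlgebraTensorModule.rid R S S).toLinearMap ∘ₗ (α i).baseChange S).smulRight
        ((1 : S) ⊗ₜ[R] β i) := by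
    intro i
    ext m
    simp [TensorProduct.smul_tmul']
  have hsum : (b ∘ₗ a).baseChange S = ∑ i ∈ F, ((α i).smulRight (β i)).baseChange S := by
    ext m
    simp [h, TensorProduct.tmul_sum]
  rw [hsum, map_sum, map_sum]
  refine Finset.sum_congr rfl fun i _ => ?_
  rw [hrank, LinearMap.trace_smulRight]
  simp [Algebra.algebraMap_eq_smul_one]

/-- If `s • g` agrees with multiplication by `x` after base change to `S`, then the traces of
the two maps agree. -/
lemma algebraMap_mul_trace_baseChange {R M : Type*} [CommRing R] [AddCommGroup M]
    [Module R M] [Module.Finite R M] (g : Module.End R M) (s x : R)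
    (S : Type*) [CommRing S] [Nontrivial S] [Algebra R S] [Module.Free S (S ⊗[R] M)]
    (h : ∀ m, ∃ c : R, IsUnit (algebraMap R S c) ∧ c • s • g m = c • x • m) :
    algebraMap R S s * LinearMap.trace S (S ⊗[R] M) (g.baseChange S) =
      algebraMap R S x * Module.finrank S (S ⊗[R] M) := by
  have key : algebraMap R S s • g.baseChange S = algebraMap R S x • LinearMap.id := by
    ext m
    obtain ⟨c, hc, hcm⟩ := h m
    have h1 : algebraMap R S c • ((1 : S) ⊗ₜ[R] (s • g m)) =
        algebraMap R S c • ((1 : S) ⊗ₜ[R] (x • m)) := by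
      rw [algebraMap_smul, algebraMap_smul, ← tmul_smul, ← tmul_smul, hcm]
    have h2 := hc.smul_left_cancel.1 h1
    simpa [algebraMap_smul, tmul_smul] using h2
  have := congrArg (LinearMap.trace S (S ⊗[R] M)) key
  simpa only [map_smul, LinearMap.trace_id, smul_eq_mul] using this

/-- A local ring whose depth is positive has a nonzerodivisor in its maximal ideal. -/
lemma exists_nonZeroDivisor_mem_maximalIdeal {R : Type*} [CommRing R] [IsLocalRing R]
    (h : moduleDepth R R ≠ 0) :
    ∃ a ∈ IsLocalRing.maximalIdeal R, a ∈ nonZeroDivisors R := by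
  by_contra! hno
  apply h
  rw [moduleDepth, ← bot_eq_zero]
  simp only [iSup_eq_bot]
  intro rs hrs hmem
  cases rs with
  | nil => simp
  | cons a t =>
    refine absurd ?_ (hno a (hmem a (by simp)))
    have ha := ((RingTheory.Sequence.isRegular_cons_iff R a t).1 hrs).1
    rw [mem_nonZeroDivisors_iff_right]
    intro y hy
    exact ha.right_eq_zero_of_smul (by simpa [mul_comm] using hy)

/-- The rank of a module that is free at a prime `p` can be computed over the residue field. -/
lemma finrank_localization_atPrime_tensor {R M : Type*} [CommRing R] [AddCommGroup M]
    [Module R M] (p : Ideal R) [p.IsPrime]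
    (K : Type*) [Field K] [Algebra (R ⧸ p) K] [IsFractionRing (R ⧸ p) K]
    [Algebra R K] [IsScalarTower R (R ⧸ p) K]
    [Module.Free (Localization.AtPrime p) (Localization.AtPrime p ⊗[R] M)] :
    Module.finrank (Localization.AtPrime p) (Localization.AtPrime p ⊗[R] M) =
      Module.finrank K (K ⊗[R] M) := by
  have hunit : ∀ y : p.primeCompl, IsUnit (algebraMap R K y) := by
    intro y
    rw [isUnit_iff_ne_zero, IsScalarTower.algebraMap_apply R (R ⧸ p) K, ne_eq,
      FaithfulSMul.algebraMap_eq_zero_iff, Ideal.Quotient.algebraMap_eq,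
      Ideal.Quotient.eq_zero_iff_mem]
    exact y.2
  let _ : Algebra (Localization.AtPrime p) K := (IsLocalization.lift hunit).toAlgebra
  have : IsScalarTower R (Localization.AtPrime p) K :=
    IsScalarTower.of_algebraMap_eq fun y => (IsLocalization.lift_eq hunit y).symm
  rw [← Module.finrank_baseChange (R := K)]
  exact (AlgebraTensorModule.cancelBaseChange R (Localization.AtPrime p) K K M).finrank_eq

/-- In a local ring of dimension at most one, primes different from the maximal ideal are
minimal. -/
lemma eq_of_le_of_ne_maximalIdeal {R : Type*} [CommRing R] [IsLocalRing R]
    (hdim : ringKrullDim R ≤ 1) {p q : Ideal R} (hp : p.IsPrime) (hq : q.IsPrime)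
    (hpq : p ≤ q) (hqm : q ≠ IsLocalRing.maximalIdeal R) : p = q := by
  rcases Order.krullDim_le_one_iff.1 hdim ⟨q, hq⟩ with h | h
  · exact le_antisymm hpq (h (b := ⟨p, hp⟩) hpq)
  · exact absurd (le_antisymm (IsLocalRing.le_maximalIdeal hq.ne_top)
      (h (b := ⟨IsLocalRing.maximalIdeal R, inferInstance⟩)
        (IsLocalRing.le_maximalIdeal hq.ne_top))) hqm

open TensorProduct in
/-- Let `R` be a one-dimensional Gorenstein complete Noetherian local ring which is not
regular, `𝔭` a minimal prime, and `γ = z·γ̃' ∉ R` as in the text.  Let `M` be an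
indecomposable finitely generated maximal Cohen-Macaulay `R`-module, not free, locally free
at all nonmaximal primes, and let `n = dim_{Q'}(M ⊗_R Q')`.  If `n·1_R` is a unit in `R`,
then any `g ∈ End_R(M)` with `g ⊗ Q` equal to multiplication by `γ` does not factor through
a projective `R`-module. -/
theorem gamma_endomorphism_not_stablyZero
    (R : Type u) [CommRing R] [IsNoetherianRing R] [IsLocalRing R]
    [IsAdicComplete (IsLocalRing.maximalIdeal R) R]
    [HasExt.{u} (ModuleCat.{u} R)]
    (hdim : ringKrullDim R = 1) (hGor : IsGorensteinOneDim R)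
    (hnotreg : ¬ IsRegularLocal R)
    (p : Ideal R) (hp : p ∈ minimalPrimes R)
    (Q : Type*) [CommRing Q] [Algebra R Q] [IsLocalization (nonZeroDivisors R) Q]
    (Q' : Type*) [Field Q'] [Algebra (R ⧸ p) Q'] [IsFractionRing (R ⧸ p) Q']
    [Algebra R Q'] [IsScalarTower R (R ⧸ p) Q']
    (π : Q →ₐ[R] Q') (hπ : Function.Surjective π)
    (γt : Q)
    (h1 : ∀ x : integralClosure (R ⧸ p) Q', ¬IsUnit x →
      π γt * (x : Q') ∈ (algebraMap (R ⧸ p) Q').range)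
    (h2 : π γt ∉ (algebraMap (R ⧸ p) Q').range)
    (z : R) (hz : ∀ r : R, r * z = 0 ↔ r ∈ p)
    (γ : Q) (hγdef : γ = algebraMap R Q z * γt)
    (hγ : γ ∉ (algebraMap R Q).range)
    (M : Type u) [AddCommGroup M] [Module R M] [Module.Finite R M]
    (hMCM : (moduleDepth R M : WithBot ℕ∞) = ringKrullDim R)
    (hind : IsIndecomposableModule R M) (hnotfree : ¬ Module.Free R M)
    (hloc : ∀ (q : Ideal R) (_ : q.IsPrime), q ≠ IsLocalRing.maximalIdeal R →
      Module.Free (Localization.AtPrime q) (LocalizedModule q.primeCompl M))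
    (hn : IsUnit ((Module.finrank Q' (Q' ⊗[R] M) : R))) :
    ∀ g : Module.End R M, LinearMap.baseChange Q (g : M →ₗ[R] M) =
        γ • (LinearMap.id : Q ⊗[R] M →ₗ[Q] Q ⊗[R] M) →
      ¬∃ (P : Type u) (_ : AddCommGroup P) (_ : Module R P), Module.Projective R P ∧
        ∃ (a : M →ₗ[R] P) (b : P →ₗ[R] M), (g : M →ₗ[R] M) = b ∘ₗ a := by
  rintro g hg ⟨P, _, _, _, a, b, rfl⟩
  obtain ⟨r, hr⟩ := exists_trace_baseChange_eq_algebraMap.{u, u, u, u} a b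
  have hp' : p.IsPrime := hp.1.1
  obtain ⟨d, hdm, hd⟩ := exists_nonZeroDivisor_mem_maximalIdeal (R := R) <| by
    intro h0
    have := hGor.1
    rw [h0, hdim] at this
    exact absurd this (by simp)
  set n := Module.finrank Q' (Q' ⊗[R] M)
  obtain ⟨⟨x, s⟩, hxs⟩ := IsLocalization.surj (nonZeroDivisors R) γ
  replace hxs : γ * algebraMap R Q s = algebraMap R Q x := hxs
  have hinj := IsLocalization.injective Q (le_refl (nonZeroDivisors R))
  have hloc_eq : ∀ m, ∃ c ∈ nonZeroDivisors R,
      c • (s : R) • (b ∘ₗ a) m = c • x • m := by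
    intro m
    have h : TensorProduct.mk R Q M 1 ((s : R) • (b ∘ₗ a) m) =
        TensorProduct.mk R Q M 1 (x • m) := by
      have h3 := LinearMap.congr_fun hg ((1 : Q) ⊗ₜ[R] m)
      have h4 := congrArg (algebraMap R Q s • ·) h3
      simp only [LinearMap.baseChange_tmul, LinearMap.smul_apply, LinearMap.id_apply,
        smul_smul, mul_comm _ γ, hxs, algebraMap_smul] at h4
      simpa [tmul_smul] using h4
    obtain ⟨c, hc⟩ := IsLocalizedModule.exists_of_eq (S := nonZeroDivisors R) h
    exact ⟨c, c.2, hc⟩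
  -- The trace identity `n * x = r * s` holds locally at every prime of `Q`.
  have hprime : ∀ q : Ideal R, q.IsPrime → (∀ c ∈ nonZeroDivisors R, c ∉ q) →
      ∃ t ∉ q, t * (x * n) = t * (s * r) := by
    intro q hq hqd
    have hqm : q ≠ IsLocalRing.maximalIdeal R := fun h => hqd d hd (h ▸ hdm)
    have := hloc q hq hqm
    have : Module.Free (Localization.AtPrime q) (Localization.AtPrime q ⊗[R] M) :=
      Module.Free.of_equiv (LocalizedModule.equivTensorProduct q.primeCompl M)
    have htr := algebraMap_mul_trace_baseChange (b ∘ₗ a) (s : R) x (Localization.AtPrime q)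
      fun m => by
        obtain ⟨c, hc, hcm⟩ := hloc_eq m
        exact ⟨c, IsLocalization.map_units (M := q.primeCompl) _ ⟨c, hqd c hc⟩, hcm⟩
    rw [hr] at htr
    suffices h : algebraMap R (Localization.AtPrime q) (x * n) =
        algebraMap R (Localization.AtPrime q) (s * r) by
      obtain ⟨c, hc⟩ := IsLocalization.exists_of_eq (M := q.primeCompl) h
      exact ⟨c, c.2, hc⟩
    rw [map_mul, map_mul, htr, map_natCast]
    by_cases hpq : p ≤ q
    · obtain rfl := eq_of_le_of_ne_maximalIdeal hdim.le hp' hq hpq hqm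
      rw [finrank_localization_atPrime_tensor p Q']
    · obtain ⟨t, htp, htq⟩ := SetLike.not_le_iff_exists.1 hpq
      have htx : t * x = 0 := by
        apply hinj
        rw [map_mul, ← hxs, hγdef, map_zero]
        have htz : algebraMap R Q t * algebraMap R Q z = 0 := by
          rw [← map_mul, (hz t).2 htp, map_zero]
        linear_combination γt * algebraMap R Q s * htz
      have hx0 : algebraMap R (Localization.AtPrime q) x = 0 :=
        (IsLocalization.map_eq_zero_iff q.primeCompl _ x).2 ⟨⟨t, htq⟩, htx⟩
      rw [hx0, zero_mul, zero_mul]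
  have hglobal : algebraMap R Q (x * n) = algebraMap R Q (s * r) := by
    by_contra hne
    let I : Ideal Q := Ideal.span {algebraMap R Q (x * n) - algebraMap R Q (s * r)}
    obtain ⟨N, hN, hIN⟩ := Ideal.exists_le_maximal
      (Submodule.annihilator I) (by
        rw [ne_eq, Submodule.annihilator_eq_top_iff, Ideal.span_singleton_eq_bot, sub_eq_zero]
        exact hne)
    obtain ⟨t, ht, hteq⟩ := hprime (N.comap (algebraMap R Q)) inferInstance fun c hc hcN =>
      hN.ne_top (Ideal.eq_top_of_isUnit_mem _ hcN (IsLocalization.map_units Q ⟨c, hc⟩))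
    refine ht (hIN ((Submodule.mem_annihilator_span_singleton _ _).2 ?_))
    rw [smul_eq_mul, mul_sub, ← map_mul, ← map_mul, hteq, sub_self]
  obtain ⟨v, hv⟩ := hn.exists_right_inv
  apply hγ
  refine ⟨r * v, ?_⟩
  have hs : IsUnit (algebraMap R Q s) := IsLocalization.map_units Q s
  apply hs.mul_left_cancel
  have hv' : algebraMap R Q n * algebraMap R Q v = 1 := by rw [← map_mul, hv, map_one]
  rw [map_mul] at hglobal ⊢
  rw [map_mul] at hglobal
  linear_combination (-algebraMap R Q v) * hglobal - hxs + algebraMap R Q x * hv'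
end
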